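/- Adopt the data of a rational plane curve: k an algebraically closed field, B = k[x,y], g₁, g₂, g₃ forms of degree d generating a height-2 ideal I minimally, with the morphism Ψ: ℙ¹ → C ⊆ ℙ² birational, and φ a homogeneous Hilbert–Burch matrix with column degrees d₁ ≤ d₂ (d₁ + d₂ = d). Then for every point p on C: (1) the multiplicity m_p of C at p satisfies m_p ≤ d₂; (2) if m_p < d₂ then m_p ≤ d₁; and (3) C has a singularity of multiplicity d−1 if and only if d₁ = 1. -/

import Mathlib

set_option maxHeartbeats 1000000
set_option synthInstance.maxHeartbeats 1000000
open MvPolynomial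

/-- The height of an ideal: the infimum of the heights of the primes containing it. -/
noncomputable def idealHeight {R : Type*} [CommRing R] (I : Ideal R) : ℕ∞ :=
  ⨅ (P : PrimeSpectrum R) (_ : I ≤ P.asIdeal), Order.height P

/-- `e` is the Hilbert–Samuel multiplicity of the ideal `J` on the (one-dimensional) ring `R`,
characterized as the limit of `λ(R/Jⁿ)/n`; lengths are expressed as Krull dimensions of
submodule lattices. -/
def IsHSMultOfDimOne (R : Type*) [CommRing R] (J : Ideal R) (e : ℕ) : Prop :=
  ∃ len : ℕ → ℕ,
    (∀ n : ℕ, Order.krullDim (Submodule R (R ⧸ J ^ n)) = ((len n : ℕ∞) : WithBot ℕ∞)) ∧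
    Filter.Tendsto (fun n : ℕ => (len n : ℝ) / (n : ℝ)) Filter.atTop (nhds (e : ℝ))

/-- The ideal of nonunits of a subring (the maximal ideal, when the subring is local). -/
def nuIdeal {K : Type*} [CommRing K] (O : Subring K) : Ideal O :=
  Ideal.span {x : O | ¬IsUnit x}

/-- The homogeneous coordinate ring `k[g₁,g₂,g₃]` of the parameterized plane curve. -/
noncomputable def coneRing {k : Type*} [Field k] (g : Fin 3 → MvPolynomial (Fin 2) k) :
    Subalgebra k (MvPolynomial (Fin 2) k) :=
  Algebra.adjoin k (Set.range g)

/-- The generators `g i`, as elements of `k[g₁,g₂,g₃]`. -/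
noncomputable def coneGen {k : Type*} [Field k] (g : Fin 3 → MvPolynomial (Fin 2) k)
    (i : Fin 3) : coneRing g :=
  ⟨g i, Algebra.subset_adjoin ⟨i, rfl⟩⟩

/-- The homogeneous prime of `k[g₁,g₂,g₃]` corresponding to the point `p = [a₁:a₂:a₃]` of the
curve: the ideal of `2 × 2` minors of the matrix with rows `(a₁,a₂,a₃)` and `(g₁,g₂,g₃)`. -/
noncomputable def pointIdeal {k : Type*} [Field k] (g : Fin 3 → MvPolynomial (Fin 2) k)
    (a : Fin 3 → k) : Ideal (coneRing g) :=
  Ideal.span {x : coneRing g | ∃ i j : Fin 3, x = a i • coneGen g j - a j • coneGen g i}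

/-- The local ring `O_{C,p}` of the curve `C` at the point `p = [a₁:a₂:a₃]`, realized as the
subring of the total quotient ring of `k[g₁,g₂,g₃]` consisting of fractions `f/s` with `f`, `s`
homogeneous of the same degree and `s ∉ 𝔭`. -/
noncomputable def curveLocalRing {k : Type*} [Field k] (g : Fin 3 → MvPolynomial (Fin 2) k)
    (a : Fin 3 → k) : Subring (FractionRing (coneRing g)) :=
  Subring.closure
    {x : FractionRing (coneRing g) |
      ∃ f s : coneRing g, ∃ e : ℕ,
        ((f : MvPolynomial (Fin 2) k).IsHomogeneous e) ∧
        ((s : MvPolynomial (Fin 2) k).IsHomogeneous e) ∧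
        s ∉ pointIdeal g a ∧
        algebraMap (coneRing g) (FractionRing (coneRing g)) s * x =
          algebraMap (coneRing g) (FractionRing (coneRing g)) f}

/-- `[a₁:a₂:a₃]` lies on the curve parameterized by `g₁, g₂, g₃`. -/
def onCurve {k : Type*} [Field k] (g : Fin 3 → MvPolynomial (Fin 2) k) (a : Fin 3 → k) : Prop :=
  ∃ q : Fin 2 → k, q ≠ 0 ∧ ∃ t : k, t ≠ 0 ∧ ∀ i, a i = t * eval q (g i)

section BinaryForms

variable {k : Type*} [Field k]

/-- forms of degree `D` in two variables -/
noncomputable abbrev VV (k : Type*) [Field k] (D : ℕ) : Submodule k (MvPolynomial (Fin 2) k) :=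
  homogeneousSubmodule (Fin 2) k D

lemma VV_mul (m n : ℕ) : VV k m * VV k n = VV k (m + n) := by
  unfold VV
  rw [← homogeneousSubmodule_one_pow (σ := Fin 2) (R := k) m, ← homogeneousSubmodule_one_pow (σ := Fin 2) (R := k) n,
    ← homogeneousSubmodule_one_pow (σ := Fin 2) (R := k) (m + n), ← pow_add]

instance VV_fd (D : ℕ) : FiniteDimensional k (VV k D) :=
  Module.Finite.iff_fg.mpr (homogeneousSubmodule_fg (σ := Fin 2) (R := k) D)

lemma finrank_VV (D : ℕ) : Module.finrank k (VV k D) = D + 1 := by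
  have h := homogeneousSubmodule_eq_finsupp_supported (Fin 2) k D
  have e1 : VV k D ≃ₗ[k] ({s : Fin 2 →₀ ℕ | s.degree = D} →₀ k) :=
    LinearEquiv.trans (LinearEquiv.ofEq (VV k D) _ h)
      (AddMonoidAlgebra.supportedEquivFinsupp (R := k) (S := k)
        {s : Fin 2 →₀ ℕ | s.degree = D})
  let e2 : {s : Fin 2 →₀ ℕ | s.degree = D} ≃ Fin (D + 1) :=
    { toFun := fun s => ⟨s.1 0, by
        have := s.2
        simp only [Set.mem_ofPred_eq, Finsupp.degree_eq_sum, Fin.sum_univ_two] at this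
        omega⟩
      invFun := fun i => ⟨Finsupp.equivFunOnFinite.symm ![i.1, D - i.1], by
        simp only [Set.mem_ofPred_eq, Finsupp.degree_eq_sum, Fin.sum_univ_two]
        simp
        omega⟩
      left_inv := fun s => by
        have := s.2
        simp only [Set.mem_ofPred_eq, Finsupp.degree_eq_sum, Fin.sum_univ_two] at this
        ext j
        fin_cases j
        · simp
        · simp; omega
      right_inv := fun i => by ext; simp }
  rw [(e1.trans (Finsupp.domLCongr e2)).finrank_eq, Module.finrank_finsupp_self, Fintype.card_fin]

/-- `f(Tx, Ty)` -/
noncomputable def scaleHom (k : Type*) [Field k] :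
    MvPolynomial (Fin 2) k →ₐ[k] Polynomial (MvPolynomial (Fin 2) k) :=
  aeval (fun i => Polynomial.C (X i) * Polynomial.X)

lemma scaleHom_coeff (f : MvPolynomial (Fin 2) k) (n : ℕ) :
    (scaleHom k f).coeff n = homogeneousComponent n f := by
  induction f using MvPolynomial.induction_on' with
  | add p q hp hq => simp [hp, hq]
  | monomial s r =>
    have : scaleHom k (monomial s r) = Polynomial.monomial s.degree (monomial s r) := by
      rw [scaleHom, aeval_monomial]
      rw [Finsupp.prod_fintype _ _ (by simp)]
      simp only [Fin.prod_univ_two, mul_pow]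
      rw [← Polynomial.C_mul_X_pow_eq_monomial, monomial_eq, Finsupp.prod_fintype _ _ (by simp)]
      simp only [Fin.prod_univ_two, Finsupp.degree_eq_sum, map_mul, map_pow, Fin.sum_univ_two, pow_add]
      have : (algebraMap k (Polynomial (MvPolynomial (Fin 2) k))) r = Polynomial.C (C r) := rfl
      rw [this]; ring
    rw [this, Polynomial.coeff_monomial]
    have hm : (monomial s r) ∈ homogeneousSubmodule (Fin 2) k s.degree :=
      isHomogeneous_monomial r rfl
    rw [homogeneousComponent_of_mem hm]
    simp [eq_comm]

lemma homog_factor {f g : MvPolynomial (Fin 2) k} {n : ℕ} (h : (f * g).IsHomogeneous n)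
    (h0 : f * g ≠ 0) : ∃ i j, i + j = n ∧ f.IsHomogeneous i ∧ g.IsHomogeneous j := by
  have hinj : ∀ f : MvPolynomial (Fin 2) k, scaleHom k f = 0 → f = 0 := by
    intro f hf
    rw [← sum_homogeneousComponent f]
    refine Finset.sum_eq_zero fun i _ => ?_
    rw [← scaleHom_coeff, hf]; simp
  have hf : scaleHom k f ≠ 0 := fun h => h0 (by rw [hinj f h, zero_mul])
  have hg : scaleHom k g ≠ 0 := fun h => h0 (by rw [hinj g h, mul_zero])
  have hfg : scaleHom k f * scaleHom k g = Polynomial.monomial n (f * g) := by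
    rw [← map_mul]
    ext1 j
    rw [scaleHom_coeff, Polynomial.coeff_monomial,
      homogeneousComponent_of_mem ((mem_homogeneousSubmodule n _).mpr h)]
    simp [eq_comm]
  have h1 := congrArg Polynomial.natDegree hfg
  have h2 := congrArg Polynomial.natTrailingDegree hfg
  rw [Polynomial.natDegree_mul hf hg, Polynomial.natDegree_monomial_eq _ h0] at h1
  rw [Polynomial.natTrailingDegree_mul hf hg, Polynomial.natTrailingDegree_monomial h0] at h2
  have h3 := (scaleHom k f).natTrailingDegree_le_natDegree
  have h4 := (scaleHom k g).natTrailingDegree_le_natDegree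
  have key : ∀ f : MvPolynomial (Fin 2) k,
      (scaleHom k f).natTrailingDegree = (scaleHom k f).natDegree →
      f.IsHomogeneous (scaleHom k f).natDegree := by
    intro f hf
    have : f = homogeneousComponent (scaleHom k f).natDegree f := by
      conv_lhs => rw [← sum_homogeneousComponent f]
      by_cases hlt : (scaleHom k f).natDegree < f.totalDegree + 1
      · refine Finset.sum_eq_single_of_mem _ (Finset.mem_range.mpr hlt) fun i _ hi => ?_
        rw [← scaleHom_coeff]
        rcases lt_or_gt_of_ne hi with h | h
        · exact Polynomial.coeff_eq_zero_of_lt_natTrailingDegree (hf ▸ h)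
        · exact Polynomial.coeff_eq_zero_of_natDegree_lt h
      · rw [homogeneousComponent_eq_zero _ _ (by omega)]
        refine Finset.sum_eq_zero fun i hi => ?_
        rw [← scaleHom_coeff]
        rw [Finset.mem_range] at hi
        exact Polynomial.coeff_eq_zero_of_lt_natTrailingDegree (by omega)
    have h2 := homogeneousComponent_isHomogeneous (scaleHom k f).natDegree f
    rwa [← this] at h2
  exact ⟨_, _, h1, key f (by omega), key g (by omega)⟩

/-- multiples of `p` by forms of degree `D` -/
noncomputable abbrev mulV (p : MvPolynomial (Fin 2) k) (D : ℕ) :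
    Submodule k (MvPolynomial (Fin 2) k) :=
  (VV k D).map (LinearMap.mulLeft k p)

lemma finrank_mulV {p : MvPolynomial (Fin 2) k} (hp : p ≠ 0) (D : ℕ) :
    Module.finrank k (mulV p D) = D + 1 := by
  rw [← finrank_VV (k := k) D]
  exact (LinearEquiv.finrank_eq
    ((VV k D).equivMapOfInjective _ (fun x y h => mul_left_cancel₀ hp h))).symm

lemma VV_le_of_coprime {p q : MvPolynomial (Fin 2) k} {α β D : ℕ} (hp : p.IsHomogeneous α)
    (hq : q.IsHomogeneous β) (hp0 : p ≠ 0) (hq0 : q ≠ 0) (hpq : IsRelPrime p q)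
    (hD : α + β ≤ D) : VV k D ≤ mulV p (D - α) ⊔ mulV q (D - β) := by
  have hle : mulV p (D - α) ⊔ mulV q (D - β) ≤ VV k D := by
    refine sup_le ?_ ?_
    · rintro _ ⟨x, hx, rfl⟩
      have := hp.mul hx
      rwa [show α + (D - α) = D by omega] at this
    · rintro _ ⟨x, hx, rfl⟩
      have := hq.mul hx
      rwa [show β + (D - β) = D by omega] at this
  have hinf : mulV p (D - α) ⊓ mulV q (D - β) ≤ mulV (p * q) (D - α - β) := by
    rintro _ ⟨⟨x, hx, rfl⟩, ⟨y, hy, hxy⟩⟩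
    simp only [LinearMap.mulLeft_apply] at hxy ⊢
    have : q ∣ x := (hpq.symm).dvd_of_dvd_mul_left ⟨y, hxy.symm⟩
    obtain ⟨z, rfl⟩ := this
    by_cases hz : q * z = 0
    · rw [hz, mul_zero]; exact zero_mem _
    obtain ⟨i, j, hij, hi, hj⟩ := homog_factor (k := k) hx hz
    have : i = β := hi.inj_right hq hq0
    refine ⟨z, ?_, by simp only [LinearMap.mulLeft_apply, mul_assoc]⟩
    have : j = D - α - β := by omega
    rw [← this]; exact hj
  have h1 := Submodule.finrank_sup_add_finrank_inf_eq (mulV p (D - α)) (mulV q (D - β))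
  have h2 := Submodule.finrank_mono hinf
  rw [finrank_mulV hp0, finrank_mulV hq0] at h1
  rw [finrank_mulV (mul_ne_zero hp0 hq0)] at h2
  refine (Submodule.eq_of_le_of_finrank_le hle ?_).ge
  rw [finrank_VV]
  omega

end BinaryForms

section GradedPieces

variable {k : Type*} [Field k]

lemma pow_homog {d : ℕ} {L : Submodule k (MvPolynomial (Fin 2) k)} (hL : L ≤ VV k d) (n : ℕ) :
    L ^ n ≤ VV k (d * n) := by
  induction n with
  | zero => simp [VV, homogeneousSubmodule_zero]
  | succ n ih =>
    rw [pow_succ, mul_add, mul_one, ← VV_mul]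
    exact mul_le_mul' ih hL

lemma pow_le_adjoin (g : Fin 3 → MvPolynomial (Fin 2) k) (n : ℕ) :
    (Submodule.span k (Set.range g)) ^ n ≤
      Subalgebra.toSubmodule (Algebra.adjoin k (Set.range g)) := by
  induction n with
  | zero =>
    rw [pow_zero, Submodule.one_le]
    exact one_mem (Algebra.adjoin k (Set.range g))
  | succ n ih =>
    rw [pow_succ, Submodule.mul_le]
    intro x hx y hy
    exact mul_mem (S := Subalgebra k (MvPolynomial (Fin 2) k)) (ih hx)
      (Algebra.span_le_adjoin k _ hy)

lemma adjoin_comp {d : ℕ} (hd : 0 < d) {g : Fin 3 → MvPolynomial (Fin 2) k}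
    (hg : ∀ i, (g i).IsHomogeneous d) {f : MvPolynomial (Fin 2) k}
    (hf : f ∈ Algebra.adjoin k (Set.range g)) (e : ℕ) :
    (d ∣ e → homogeneousComponent e f ∈ (Submodule.span k (Set.range g)) ^ (e / d)) ∧
      (¬ d ∣ e → homogeneousComponent e f = 0) := by
  have hL : Submodule.span k (Set.range g) ≤ VV k d := by
    rw [Submodule.span_le]; rintro _ ⟨i, rfl⟩; exact hg i
  have hf' : f ∈ Submodule.span k (Submonoid.closure (Set.range g) : Set (MvPolynomial (Fin 2) k)) := by
    rw [← Algebra.adjoin_eq_span]; exact hf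
  have hmon : ∀ f ∈ Submonoid.closure (Set.range g),
      ∃ j, f ∈ (Submodule.span k (Set.range g)) ^ j := by
    intro f hf
    induction hf using Submonoid.closure_induction with
    | mem x hx => exact ⟨1, by rw [pow_one]; exact Submodule.subset_span hx⟩
    | one => exact ⟨0, by rw [pow_zero]; exact Submodule.one_le.mp le_rfl⟩
    | mul x y _ _ hx hy =>
      obtain ⟨i, hi⟩ := hx
      obtain ⟨j, hj⟩ := hy
      exact ⟨i + j, by rw [pow_add]; exact Submodule.mul_mem_mul hi hj⟩
  induction hf' using Submodule.span_induction with
  | mem x hx =>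
    obtain ⟨j, hj⟩ := hmon x hx
    rw [homogeneousComponent_of_mem (pow_homog hL j hj)]
    constructor
    · intro hde
      split_ifs with h
      · rw [h, Nat.mul_div_cancel_left _ hd]; exact hj
      · exact zero_mem _
    · intro hde
      rw [if_neg]
      rintro rfl
      exact hde ⟨j, rfl⟩
  | zero => simp
  | add x y hx hy h1 h2 =>
    have hx' : x ∈ Algebra.adjoin k (Set.range g) := by
      rw [← Algebra.adjoin_eq_span] at hx; exact hx
    have hy' : y ∈ Algebra.adjoin k (Set.range g) := by
      rw [← Algebra.adjoin_eq_span] at hy; exact hy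
    refine ⟨fun h => ?_, fun h => ?_⟩
    · rw [map_add]; exact add_mem ((h1 hx').1 h) ((h2 hy').1 h)
    · rw [map_add, (h1 hx').2 h, (h2 hy').2 h, add_zero]
  | smul r x hx h1 =>
    have hx' : x ∈ Algebra.adjoin k (Set.range g) := by
      rw [← Algebra.adjoin_eq_span] at hx; exact hx
    refine ⟨fun h => ?_, fun h => ?_⟩
    · rw [map_smul]; exact Submodule.smul_mem _ _ ((h1 hx').1 h)
    · rw [map_smul, (h1 hx').2 h, smul_zero]

lemma adjoin_homog {d : ℕ} (hd : 0 < d) {g : Fin 3 → MvPolynomial (Fin 2) k}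
    (hg : ∀ i, (g i).IsHomogeneous d) {f : MvPolynomial (Fin 2) k}
    (hf : f ∈ Algebra.adjoin k (Set.range g)) {e : ℕ} (hfe : f.IsHomogeneous e) (hf0 : f ≠ 0) :
    ∃ j, e = d * j ∧ f ∈ (Submodule.span k (Set.range g)) ^ j := by
  have h := adjoin_comp hd hg hf e
  rw [homogeneousComponent_eq_self hfe] at h
  by_cases hde : d ∣ e
  · exact ⟨e / d, (Nat.mul_div_cancel' hde).symm, h.1 hde⟩
  · exact absurd (h.2 hde) hf0

/-- Coordinates adapted to a point of the curve: `h₁, h₂` span the linear forms vanishing at the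
point, `c` is their gcd. -/
structure PData (d : ℕ) (g : Fin 3 → MvPolynomial (Fin 2) k)
    (h0 h1 h2 c p1 p2 : MvPolynomial (Fin 2) k) (e δ : ℕ) : Prop where
  hd : 0 < d
  hg : ∀ i, (g i).IsHomogeneous d
  hL : Submodule.span k {h0, h1, h2} = Submodule.span k (Set.range g)
  h00 : h0 ≠ 0
  hc0 : c ≠ 0
  hp10 : p1 ≠ 0
  hp20 : p2 ≠ 0
  hh1 : h1 = c * p1
  hh2 : h2 = c * p2
  hc : c.IsHomogeneous e
  hp1 : p1.IsHomogeneous δ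
  hp2 : p2.IsHomogeneous δ
  hed : e + δ = d
  hp : IsRelPrime p1 p2
  hch : IsRelPrime c h0

/-- `h(g)`: the span of the three forms. -/
noncomputable abbrev LL (g : Fin 3 → MvPolynomial (Fin 2) k) :
    Submodule k (MvPolynomial (Fin 2) k) := Submodule.span k (Set.range g)

variable {d : ℕ} {g : Fin 3 → MvPolynomial (Fin 2) k}
    {h0 h1 h2 c p1 p2 : MvPolynomial (Fin 2) k} {e δ : ℕ}

namespace PData


lemma L_le (H : PData d g h0 h1 h2 c p1 p2 e δ) : LL g ≤ VV k d := by
  rw [Submodule.span_le]; rintro _ ⟨i, rfl⟩; exact H.hg i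

lemma mem0 (H : PData d g h0 h1 h2 c p1 p2 e δ) : h0 ∈ LL g := H.hL.le (Submodule.subset_span (by simp))
lemma mem1 (H : PData d g h0 h1 h2 c p1 p2 e δ) : h1 ∈ LL g := H.hL.le (Submodule.subset_span (by simp))
lemma mem2 (H : PData d g h0 h1 h2 c p1 p2 e δ) : h2 ∈ LL g := H.hL.le (Submodule.subset_span (by simp))

lemma Pstep (H : PData d g h0 h1 h2 c p1 p2 e δ) {D : ℕ} (hD : δ ≤ D) :
    VV k (D + δ) ≤ Submodule.span k {p1, p2} * VV k D := by
  refine (VV_le_of_coprime H.hp1 H.hp2 H.hp10 H.hp20 H.hp (by omega)).trans ?_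
  rw [Nat.add_sub_cancel]
  refine sup_le ?_ ?_
  · rintro _ ⟨x, hx, rfl⟩
    exact Submodule.mul_mem_mul (Submodule.subset_span (by simp)) hx
  · rintro _ ⟨x, hx, rfl⟩
    exact Submodule.mul_mem_mul (Submodule.subset_span (by simp)) hx

lemma Ppow (H : PData d g h0 h1 h2 c p1 p2 e δ) {D : ℕ} (hD : δ ≤ D) (n : ℕ) :
    VV k (D + n * δ) ≤ Submodule.span k {p1, p2} ^ n * VV k D := by
  induction n with
  | zero => simp
  | succ n ih =>
    rw [show D + (n + 1) * δ = (D + n * δ) + δ by ring]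
    refine (H.Pstep (by omega)).trans ?_
    rw [pow_succ', mul_assoc]
    exact mul_le_mul' le_rfl ih

lemma Lstep (H : PData d g h0 h1 h2 c p1 p2 e δ) {D : ℕ} (hD : d ≤ D) : VV k (D + d) ≤ LL g * VV k D := by
  have hed := H.hed
  refine (VV_le_of_coprime H.hc (H.L_le H.mem0) H.hc0 H.h00 H.hch (by omega)).trans ?_
  refine sup_le ?_ ?_
  · rintro _ ⟨x, hx, rfl⟩
    rw [show D + d - e = D + δ by omega] at hx
    have hx' := VV_le_of_coprime H.hp1 H.hp2 H.hp10 H.hp20 H.hp (by omega) hx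
    rw [Nat.add_sub_cancel] at hx'
    obtain ⟨_, ⟨x1, hx1, rfl⟩, _, ⟨x2, hx2, rfl⟩, rfl⟩ := Submodule.mem_sup.mp hx'
    simp only [LinearMap.mulLeft_apply, mul_add, ← mul_assoc, ← H.hh1, ← H.hh2]
    exact add_mem (Submodule.mul_mem_mul H.mem1 hx1) (Submodule.mul_mem_mul H.mem2 hx2)
  · rintro _ ⟨x, hx, rfl⟩
    rw [Nat.add_sub_cancel] at hx
    exact Submodule.mul_mem_mul H.mem0 hx

lemma Lpow (H : PData d g h0 h1 h2 c p1 p2 e δ) (n : ℕ) : VV k (d * (n + 1)) ≤ LL g ^ n * VV k d := by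
  induction n with
  | zero => simp
  | succ n ih =>
    rw [show d * (n + 1 + 1) = (d * (n + 1)) + d by ring]
    refine (H.Lstep (Nat.le_mul_of_pos_right _ (by omega))).trans ?_
    rw [pow_succ', mul_assoc]
    exact mul_le_mul' le_rfl ih

/-- The conductor. -/
lemma conductor (H : PData d g h0 h1 h2 c p1 p2 e δ) (hbir : ∀ v ∈ Algebra.adjoin k {f : MvPolynomial (Fin 2) k | f.IsHomogeneous d},
      ∃ x ∈ Algebra.adjoin k (Set.range g), ∃ y ∈ Algebra.adjoin k (Set.range g),
        y ≠ 0 ∧ y * v = x) :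
    ∃ s : ℕ, ∃ y ∈ LL g ^ s, y ≠ 0 ∧ ∀ j, ∀ v ∈ VV k (d * (j + 1)), y * v ∈ LL g ^ (j + 1 + s) := by
  have hone : ∀ v ∈ VV k d, ∃ s : ℕ, ∃ y ∈ LL g ^ s, y ≠ 0 ∧ y * v ∈ LL g ^ (1 + s) := by
    intro v hv
    by_cases hv0 : v = 0
    · exact ⟨0, 1, by rw [pow_zero]; exact Submodule.one_le.mp le_rfl, one_ne_zero,
        by rw [hv0, mul_zero]; exact zero_mem _⟩
    obtain ⟨x, hx, y, hy, hy0, hyx⟩ := hbir v (Algebra.subset_adjoin hv)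
    have : ∃ e, homogeneousComponent e y ≠ 0 := by
      by_contra! hall
      apply hy0
      rw [← sum_homogeneousComponent y]
      exact Finset.sum_eq_zero fun i _ => hall i
    obtain ⟨e, he⟩ := this
    have hde : d ∣ e := by
      by_contra hn
      exact he ((adjoin_comp H.hd H.hg hy e).2 hn)
    obtain ⟨s, rfl⟩ := hde
    have h1 := (adjoin_comp H.hd H.hg hy (d * s)).1 ⟨s, rfl⟩
    rw [Nat.mul_div_cancel_left _ H.hd] at h1
    refine ⟨s, _, h1, he, ?_⟩
    have h2 := (adjoin_comp H.hd H.hg hx (d * (1 + s))).1 ⟨_, rfl⟩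
    rw [Nat.mul_div_cancel_left _ H.hd, ← hyx] at h2
    convert h2 using 1
    rw [← scaleHom_coeff, ← scaleHom_coeff, map_mul]
    have hv' : scaleHom k v = Polynomial.monomial d v := by
      ext1 j
      rw [scaleHom_coeff, Polynomial.coeff_monomial, homogeneousComponent_of_mem hv]
      simp [eq_comm]
    rw [hv', show d * (1 + s) = d * s + d by ring, Polynomial.coeff_mul_monomial]
  have hfin : ∀ S : Finset (MvPolynomial (Fin 2) k), (∀ v ∈ S, v ∈ VV k d) →
      ∃ s : ℕ, ∃ y ∈ LL g ^ s, y ≠ 0 ∧ ∀ v ∈ S, y * v ∈ LL g ^ (1 + s) := by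
    classical
    intro S
    induction S using Finset.induction_on with
    | empty =>
      intro _
      exact ⟨0, 1, by rw [pow_zero]; exact Submodule.one_le.mp le_rfl, one_ne_zero, by simp⟩
    | insert w S hw ih =>
      intro hS
      obtain ⟨s, y, hy, hy0, hyS⟩ := ih fun v hv => hS v (Finset.mem_insert_of_mem hv)
      obtain ⟨t, z, hz, hz0, hzw⟩ := hone w (hS w (Finset.mem_insert_self _ _))
      refine ⟨s + t, y * z, by rw [pow_add]; exact Submodule.mul_mem_mul hy hz,
        mul_ne_zero hy0 hz0, fun v hv => ?_⟩
      rcases Finset.mem_insert.mp hv with rfl | hv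
      · rw [mul_assoc, show 1 + (s + t) = s + (1 + t) by ring, pow_add]
        exact Submodule.mul_mem_mul hy hzw
      · rw [show y * z * v = y * v * z by ring, show 1 + (s + t) = 1 + s + t by ring,
          pow_add _ (1 + s)]
        exact Submodule.mul_mem_mul (hyS v hv) hz
  obtain ⟨S, hS⟩ := homogeneousSubmodule_fg (σ := Fin 2) (R := k) d
  obtain ⟨s, y, hy, hy0, hyS⟩ := hfin S fun v hv => by
    show v ∈ homogeneousSubmodule (Fin 2) k d
    rw [← hS]; exact Submodule.subset_span hv
  have hyV : ∀ v ∈ VV k d, y * v ∈ LL g ^ (1 + s) := by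
    intro v hv
    replace hv : v ∈ homogeneousSubmodule (Fin 2) k d := hv
    rw [← hS] at hv
    have : Submodule.span k (S : Set (MvPolynomial (Fin 2) k)) ≤
        (LL g ^ (1 + s)).comap (LinearMap.mulLeft k y) := by
      rw [Submodule.span_le]; exact hyS
    exact this hv
  refine ⟨s, y, hy, hy0, fun j v hv => ?_⟩
  have hle : LL g ^ j * VV k d ≤ (LL g ^ (j + 1 + s)).comap (LinearMap.mulLeft k y) := by
    rw [Submodule.mul_le]
    intro a ha b hb
    rw [Submodule.mem_comap, LinearMap.mulLeft_apply,
      show y * (a * b) = a * (y * b) by ring, add_assoc, pow_add]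
    exact Submodule.mul_mem_mul ha (hyV b hb)
  exact hle (H.Lpow j hv)

end PData

end GradedPieces

section AbstractMult

variable {k : Type*} [Field k]

lemma length_eq_finrank_of_residue {R : Type*} [CommRing R] [IsLocalRing R] [Algebra k R]
    (hres : ∀ x : R, ∃ α : k, x - algebraMap k R α ∈ IsLocalRing.maximalIdeal R)
    (M : Type*) [AddCommGroup M] [Module R M] [Module k M] [IsScalarTower k R M]
    [FiniteDimensional k M] : Module.length R M = Module.finrank k M := by
  have h := IsLocalRing.length_restrictScalars k R M
  rw [Module.length_eq_finrank] at h
  have h1 : Module.length (IsLocalRing.ResidueField k) (IsLocalRing.ResidueField R) = 1 := by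
    have hs : Function.Surjective
        (algebraMap (IsLocalRing.ResidueField k) (IsLocalRing.ResidueField R)) := by
      intro x
      obtain ⟨x, rfl⟩ := IsLocalRing.residue_surjective x
      obtain ⟨α, hα⟩ := hres x
      refine ⟨IsLocalRing.residue k α, ?_⟩
      rw [IsLocalRing.ResidueField.algebraMap_residue]
      exact (Ideal.Quotient.eq.mpr hα).symm
    rw [Module.length_eq_of_surjective (M := IsLocalRing.ResidueField R) hs, Module.length_eq_one]
  rw [h1, mul_one] at h
  exact h.symm

variable {d : ℕ} {g : Fin 3 → MvPolynomial (Fin 2) k}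
    {h0 h1 h2 c p1 p2 : MvPolynomial (Fin 2) k} {e δ : ℕ}

theorem mult_abstract (H : PData d g h0 h1 h2 c p1 p2 e δ)
    (hbir : ∀ v ∈ Algebra.adjoin k {f : MvPolynomial (Fin 2) k | f.IsHomogeneous d},
      ∃ x ∈ Algebra.adjoin k (Set.range g), ∃ y ∈ Algebra.adjoin k (Set.range g),
        y ≠ 0 ∧ y * v = x)
    {R : Type*} [CommRing R] [IsLocalRing R] [Algebra k R]
    (T : ℕ → MvPolynomial (Fin 2) k →ₗ[k] R)
    (hT1 : T 0 1 = 1) (hT0 : T 1 h0 = 1)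
    (hTmul : ∀ N M f f', f ∈ LL g ^ N → f' ∈ LL g ^ M → T (N + M) (f * f') = T N f * T M f')
    (hu : T 1 h1 ∈ IsLocalRing.maximalIdeal R) (hv : T 1 h2 ∈ IsLocalRing.maximalIdeal R)
    (hdec : ∀ x : R, ∃ (α : k) (x1 x2 : R), x = algebraMap k R α + T 1 h1 * x1 + T 1 h2 * x2)
    (hker : ∀ N n f, f ∈ LL g ^ N → T N f ∈ IsLocalRing.maximalIdeal R ^ n → c ^ n ∣ f) :
    IsHSMultOfDimOne R (IsLocalRing.maximalIdeal R) e := by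
  set 𝔪 := IsLocalRing.maximalIdeal R with h𝔪
  have hone : (1 : MvPolynomial (Fin 2) k) ∈ LL g ^ 0 := by
    rw [pow_zero]; exact Submodule.one_le.mp le_rfl
  have hL1 : ∀ {x}, x ∈ LL g → x ∈ LL g ^ 1 := fun {x} hx => by rw [pow_one]; exact hx
  have hTpow : ∀ n, T n (h0 ^ n) = 1 := by
    intro n
    induction n with
    | zero => simpa using hT1
    | succ n ih =>
      rw [pow_succ, hTmul n 1 _ _ (Submodule.pow_mem_pow _ H.mem0 n) (hL1 H.mem0), ih, hT0, mul_one]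
  have hres : ∀ x : R, ∃ α : k, x - algebraMap k R α ∈ 𝔪 := by
    intro x
    obtain ⟨α, x1, x2, hx⟩ := hdec x
    refine ⟨α, ?_⟩
    rw [show x - algebraMap k R α = T 1 h1 * x1 + T 1 h2 * x2 by rw [hx]; ring]
    exact add_mem (Ideal.mul_mem_right _ _ hu) (Ideal.mul_mem_right _ _ hv)
  have hsurj : ∀ n, ∀ x : R, ∃ f ∈ LL g ^ n, x - T n f ∈ 𝔪 ^ (n + 1) := by
    intro n
    induction n with
    | zero =>
      intro x
      obtain ⟨α, hα⟩ := hres x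
      refine ⟨α • 1, Submodule.smul_mem _ _ hone, ?_⟩
      rw [map_smul, hT1, zero_add, pow_one, ← Algebra.algebraMap_eq_smul_one]
      exact hα
    | succ n ih =>
      intro x
      obtain ⟨α, x1, x2, hx⟩ := hdec x
      obtain ⟨f1, hf1, hx1⟩ := ih x1
      obtain ⟨f2, hf2, hx2⟩ := ih x2
      refine ⟨α • h0 ^ (n + 1) + (f1 * h1 + f2 * h2), ?_, ?_⟩
      · refine add_mem (Submodule.smul_mem _ _ (Submodule.pow_mem_pow _ H.mem0 _)) ?_
        rw [pow_succ]
        exact add_mem (Submodule.mul_mem_mul hf1 H.mem1) (Submodule.mul_mem_mul hf2 H.mem2)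
      · rw [map_add, map_smul, hTpow, map_add, hTmul n 1 _ _ hf1 (hL1 H.mem1),
          hTmul n 1 _ _ hf2 (hL1 H.mem2), ← Algebra.algebraMap_eq_smul_one]
        rw [show x - (algebraMap k R α + (T n f1 * T 1 h1 + T n f2 * T 1 h2)) =
          (x1 - T n f1) * T 1 h1 + (x2 - T n f2) * T 1 h2 by rw [hx]; ring]
        rw [pow_succ]
        exact add_mem (Ideal.mul_mem_mul hx1 hu) (Ideal.mul_mem_mul hx2 hv)
  have hW : Submodule.span k {h1, h2} ≤ LL g := by
    rw [Submodule.span_le]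
    rintro x (rfl | rfl)
    · exact H.mem1
    · exact H.mem2
  have hTW1 : ∀ x ∈ Submodule.span k {h1, h2}, T 1 x ∈ 𝔪 := by
    have : Submodule.span k {h1, h2} ≤ (𝔪.restrictScalars k).comap (T 1) := by
      rw [Submodule.span_le]
      rintro x (rfl | rfl)
      · exact hu
      · exact hv
    exact fun x hx => this hx
  have hTW : ∀ n, Submodule.span k {h1, h2} ^ n ≤
      LL g ^ n ⊓ ((𝔪 ^ n).restrictScalars k).comap (T n) := by
    intro n
    induction n with
    | zero =>
      refine le_inf (by simp) ?_
      intro x _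
      simp
    | succ n ih =>
      rw [pow_succ, Submodule.mul_le]
      intro x hx y hy
      have := ih hx
      refine ⟨?_, ?_⟩
      · rw [pow_succ]; exact Submodule.mul_mem_mul this.1 (hW hy)
      · show T (n + 1) (x * y) ∈ 𝔪 ^ (n + 1)
        rw [hTmul n 1 _ _ this.1 (hL1 (hW hy)), pow_succ]
        exact Ideal.mul_mem_mul this.2 (hTW1 y hy)
  have hTWL : ∀ n m, Submodule.span k {h1, h2} ^ n * LL g ^ m ≤
      LL g ^ (n + m) ⊓ ((𝔪 ^ n).restrictScalars k).comap (T (n + m)) := by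
    intro n m
    rw [Submodule.mul_le]
    intro x hx y hy
    have := hTW n hx
    refine ⟨?_, ?_⟩
    · rw [pow_add]; exact Submodule.mul_mem_mul this.1 hy
    · show T (n + m) (x * y) ∈ 𝔪 ^ n
      rw [hTmul n m _ _ this.1 hy]
      exact Ideal.mul_mem_right _ _ this.2
  have hcW : ∀ n, ∀ x ∈ Submodule.span k {p1, p2} ^ n, c ^ n * x ∈ Submodule.span k {h1, h2} ^ n := by
    have h1' : ∀ x ∈ Submodule.span k {p1, p2}, c * x ∈ Submodule.span k {h1, h2} := by
      have : Submodule.span k {p1, p2} ≤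
          (Submodule.span k {h1, h2}).comap (LinearMap.mulLeft k c) := by
        rw [Submodule.span_le]
        rintro x (rfl | rfl)
        · show c * x ∈ Submodule.span k {h1, h2}
          rw [← H.hh1]; exact Submodule.subset_span (by simp)
        · show c * x ∈ Submodule.span k {h1, h2}
          rw [← H.hh2]; exact Submodule.subset_span (by simp)
      exact fun x hx => this hx
    intro n
    induction n with
    | zero => intro x hx; simpa using hx
    | succ n ih =>
      have : Submodule.span k {p1, p2} ^ (n + 1) ≤
          (Submodule.span k {h1, h2} ^ (n + 1)).comap (LinearMap.mulLeft k (c ^ (n + 1))) := by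
        rw [pow_succ, Submodule.mul_le]
        intro x hx y hy
        show c ^ (n + 1) * (x * y) ∈ Submodule.span k {h1, h2} ^ (n + 1)
        rw [show c ^ (n + 1) * (x * y) = (c ^ n * x) * (c * y) by ring, pow_succ]
        exact Submodule.mul_mem_mul (ih x hx) (h1' y hy)
      exact fun x hx => this hx
  obtain ⟨s, y, hy, hy0, hyV⟩ := H.conductor hbir
  have hed := H.hed
  -- dimension estimate
  have main : ∀ n : ℕ, ∃ r : ℕ, Module.length R (R ⧸ 𝔪 ^ n) = r ∧
      r ≤ n * e + d * s ∧ n * e ≤ r + d * s := by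
    intro n
    set N := n + (1 + s) with hN
    set Kn : Submodule k (MvPolynomial (Fin 2) k) :=
      LL g ^ N ⊓ ((𝔪 ^ n).restrictScalars k).comap (T N) with hKn
    have hLN : LL g ^ N ≤ VV k (d * N) := pow_homog H.L_le N
    have hlow : mulV (y * c ^ n) (d + n * δ) ≤ Kn := by
      rintro _ ⟨b, hb, rfl⟩
      have hb' := H.Ppow (by omega) n hb
      have : Submodule.span k {p1, p2} ^ n * VV k d ≤
          Kn.comap (LinearMap.mulLeft k (y * c ^ n)) := by
        rw [Submodule.mul_le]
        intro x hx z hz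
        show y * c ^ n * (x * z) ∈ Kn
        rw [show y * c ^ n * (x * z) = (c ^ n * x) * (y * z) by ring]
        refine hTWL n (1 + s) (Submodule.mul_mem_mul (hcW n x hx) ?_)
        have := hyV 0 z (by simpa using hz)
        simpa using this
      exact this hb'
    have hup : Kn ≤ mulV (c ^ n) (d + d * s + n * δ) := by
      rintro f ⟨hf, hf2⟩
      obtain ⟨z, rfl⟩ := hker N n f hf hf2
      by_cases hz : c ^ n * z = 0
      · rw [hz]; exact zero_mem _
      obtain ⟨i, j, hij, hi, hj⟩ := homog_factor (hLN hf) hz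
      have : i = e * n := hi.inj_right (H.hc.pow n) (pow_ne_zero _ H.hc0)
      have : j = d + d * s + n * δ := by
        have : d * N = e * n + (d + d * s + n * δ) := by rw [hN, ← hed]; ring
        omega
      exact ⟨z, this ▸ hj, rfl⟩
    have hyL : mulV y (d * (n + 1)) ≤ LL g ^ N := by
      rintro _ ⟨b, hb, rfl⟩
      have := hyV n b hb
      rw [show n + 1 + s = N by omega] at this
      exact this
    haveI : FiniteDimensional k (LL g ^ N : Submodule k (MvPolynomial (Fin 2) k)) :=
      Submodule.finiteDimensional_of_le hLN
    haveI : FiniteDimensional k Kn := Submodule.finiteDimensional_of_le inf_le_left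
    have d1 := Submodule.finrank_mono hlow
    have d2 := Submodule.finrank_mono hup
    have d3 := Submodule.finrank_mono hyL
    have d4 := Submodule.finrank_mono hLN
    rw [finrank_mulV (mul_ne_zero hy0 (pow_ne_zero _ H.hc0))] at d1
    rw [finrank_mulV (pow_ne_zero _ H.hc0)] at d2
    rw [finrank_mulV hy0] at d3
    rw [finrank_VV] at d4
    let Q : ↥(LL g ^ N) →ₗ[k] (R ⧸ 𝔪 ^ n) :=
      ((𝔪 ^ n).mkQ.restrictScalars k) ∘ₗ (T N) ∘ₗ (LL g ^ N).subtype
    have hQ : Function.Surjective Q := by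
      intro x
      obtain ⟨x, rfl⟩ := Ideal.Quotient.mk_surjective x
      obtain ⟨f, hf, hx⟩ := hsurj N x
      refine ⟨⟨f, hf⟩, ?_⟩
      refine (Ideal.Quotient.eq.mpr ?_).symm
      exact Ideal.pow_le_pow_right (by omega) hx
    haveI : FiniteDimensional k (R ⧸ 𝔪 ^ n) := Module.Finite.of_surjective Q hQ
    have d5 := LinearMap.finrank_range_add_finrank_ker Q
    have d6 : Module.finrank k (LinearMap.ker Q) = Module.finrank k Kn := by
      have : Kn = (LinearMap.ker Q).map (LL g ^ N).subtype := by
        ext f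
        simp only [hKn, Submodule.mem_inf, Submodule.mem_map, LinearMap.mem_ker]
        constructor
        · rintro ⟨hf, hf2⟩
          exact ⟨⟨f, hf⟩, Ideal.Quotient.eq_zero_iff_mem.mpr hf2, rfl⟩
        · rintro ⟨⟨f, hf⟩, hf2, rfl⟩
          exact ⟨hf, Ideal.Quotient.eq_zero_iff_mem.mp hf2⟩
      rw [this]
      exact LinearEquiv.finrank_eq ((LinearMap.ker Q).equivMapOfInjective _
        (LL g ^ N).injective_subtype)
    rw [LinearMap.range_eq_top.mpr hQ, finrank_top, d6] at d5
    refine ⟨_, length_eq_finrank_of_residue hres (R ⧸ 𝔪 ^ n), ?_, ?_⟩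
    · have : d * N = n * e + n * δ + d + d * s := by rw [hN, ← hed]; ring
      omega
    · have : d * (n + 1) = n * e + n * δ + d := by rw [← hed]; ring
      omega
  choose len hlen hle hge using main
  refine ⟨len, fun n => ?_, ?_⟩
  · rw [← Module.coe_length, hlen n]
  · rw [tendsto_iff_dist_tendsto_zero]
    have hlim : Filter.Tendsto (fun n : ℕ => ((d * s : ℕ) : ℝ) / (n : ℝ)) Filter.atTop (nhds 0) :=
      tendsto_const_div_atTop_nhds_zero_nat _
    refine squeeze_zero' (Filter.Eventually.of_forall fun _ => dist_nonneg) ?_ hlim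
    filter_upwards [Filter.eventually_gt_atTop 0] with n hn
    have hn' : (0 : ℝ) < n := by exact_mod_cast hn
    rw [Real.dist_eq, div_sub' hn'.ne', abs_div, abs_of_pos hn']
    gcongr
    have a1 : (len n : ℝ) ≤ n * e + (d * s : ℕ) := by exact_mod_cast hle n
    have a2 : (n * e : ℝ) ≤ len n + (d * s : ℕ) := by exact_mod_cast hge n
    rw [abs_le]
    constructor <;> linarith

end AbstractMult

section ConcreteRing

variable {k : Type*} [Field k]

/-- `x = f / s` with `f, s` of degree `j` in the forms `g` and `s(q) ≠ 0`. -/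
def RepO (g : Fin 3 → MvPolynomial (Fin 2) k) (q : Fin 2 → k) (x : FractionRing (coneRing g))
    (j : ℕ) (f s : coneRing g) : Prop :=
  (f : MvPolynomial (Fin 2) k) ∈ LL g ^ j ∧ (s : MvPolynomial (Fin 2) k) ∈ LL g ^ j ∧
    eval q (s : MvPolynomial (Fin 2) k) ≠ 0 ∧
    algebraMap (coneRing g) (FractionRing (coneRing g)) s * x =
      algebraMap (coneRing g) (FractionRing (coneRing g)) f

lemma one_mem_LL (g : Fin 3 → MvPolynomial (Fin 2) k) : (1 : MvPolynomial (Fin 2) k) ∈ LL g ^ 0 := by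
  rw [pow_zero]; exact Submodule.one_le.mp le_rfl

variable {d : ℕ} {g : Fin 3 → MvPolynomial (Fin 2) k}
    {h0 h1 h2 c p1 p2 : MvPolynomial (Fin 2) k} {e δ : ℕ} {q : Fin 2 → k}

namespace RepO

lemma ne_zero {x j} {f s : coneRing g} (h : RepO g q x j f s) : s ≠ 0 := by
  rintro rfl
  exact h.2.2.1 (by simp)

lemma mapne {s : coneRing g} (hs : s ≠ 0) :
    algebraMap (coneRing g) (FractionRing (coneRing g)) s ≠ 0 := by
  simpa using hs

lemma add {x y i j} {f s f' s' : coneRing g} (h : RepO g q x i f s) (h' : RepO g q y j f' s') :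
    RepO g q (x + y) (i + j) (f * s' + s * f') (s * s') := by
  obtain ⟨a1, a2, a3, a4⟩ := h
  obtain ⟨b1, b2, b3, b4⟩ := h'
  refine ⟨?_, ?_, ?_, ?_⟩
  · rw [pow_add]; exact add_mem (Submodule.mul_mem_mul a1 b2) (Submodule.mul_mem_mul a2 b1)
  · rw [pow_add]; exact Submodule.mul_mem_mul a2 b2
  · simpa using ⟨a3, b3⟩
  · simp only [map_mul, map_add, ← a4, ← b4]; ring

lemma mul {x y i j} {f s f' s' : coneRing g} (h : RepO g q x i f s) (h' : RepO g q y j f' s') :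
    RepO g q (x * y) (i + j) (f * f') (s * s') := by
  obtain ⟨a1, a2, a3, a4⟩ := h
  obtain ⟨b1, b2, b3, b4⟩ := h'
  refine ⟨?_, ?_, ?_, ?_⟩
  · rw [pow_add]; exact Submodule.mul_mem_mul a1 b1
  · rw [pow_add]; exact Submodule.mul_mem_mul a2 b2
  · simpa using ⟨a3, b3⟩
  · simp only [map_mul, ← a4, ← b4]; ring

lemma neg {x i} {f s : coneRing g} (h : RepO g q x i f s) : RepO g q (-x) i (-f) s := by
  obtain ⟨a1, a2, a3, a4⟩ := h
  refine ⟨neg_mem (S := Submodule k (MvPolynomial (Fin 2) k)) a1, a2, a3, ?_⟩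
  rw [mul_neg, map_neg, a4]

lemma const (α : k) : RepO g q (algebraMap k (FractionRing (coneRing g)) α) 0
    (algebraMap k (coneRing g) α) 1 := by
  refine ⟨?_, one_mem_LL g, by simp, ?_⟩
  · have := Submodule.smul_mem _ α (one_mem_LL g)
    rwa [← Algebra.algebraMap_eq_smul_one] at this
  · rw [map_one, one_mul]; rfl

lemma inv {x i} {f s : coneRing g} (h : RepO g q x i f s)
    (hf : eval q (f : MvPolynomial (Fin 2) k) ≠ 0) : RepO g q x⁻¹ i s f := by
  obtain ⟨a1, a2, a3, a4⟩ := h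
  refine ⟨a2, a1, hf, ?_⟩
  have hf0 : f ≠ 0 := by rintro rfl; exact hf (by simp)
  have hx : x ≠ 0 := by
    rintro rfl
    rw [mul_zero] at a4
    exact mapne hf0 a4.symm
  rw [← a4, mul_assoc, mul_inv_cancel₀ hx, mul_one]

end RepO

namespace PData


lemma decomp (H : PData d g h0 h1 h2 c p1 p2 e δ) (j : ℕ) {f : MvPolynomial (Fin 2) k} (hf : f ∈ LL g ^ (j + 1)) :
    ∃ γ : k, ∃ α ∈ LL g ^ j, ∃ β ∈ LL g ^ j, f = γ • h0 ^ (j + 1) + h1 * α + h2 * β := by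
  let S : Submodule k (MvPolynomial (Fin 2) k) :=
    { carrier := {f | ∃ γ : k, ∃ α ∈ LL g ^ j, ∃ β ∈ LL g ^ j,
        f = γ • h0 ^ (j + 1) + h1 * α + h2 * β}
      add_mem' := by
        rintro _ _ ⟨γ, α, hα, β, hβ, rfl⟩ ⟨γ', α', hα', β', hβ', rfl⟩
        exact ⟨γ + γ', α + α', add_mem hα hα', β + β', add_mem hβ hβ', by rw [add_smul]; ring⟩
      zero_mem' := ⟨0, 0, zero_mem _, 0, zero_mem _, by simp⟩
      smul_mem' := by
        rintro r _ ⟨γ, α, hα, β, hβ, rfl⟩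
        exact ⟨r * γ, r • α, Submodule.smul_mem _ _ hα, r • β, Submodule.smul_mem _ _ hβ,
          by simp only [smul_add, mul_smul, mul_smul_comm]⟩ }
  suffices LL g ^ (j + 1) ≤ S from this hf
  clear hf f
  induction j with
  | zero =>
    rw [zero_add, pow_one]
    show Submodule.span k (Set.range g) ≤ S
    rw [← H.hL, Submodule.span_le]
    rintro x (rfl | rfl | rfl)
    · exact ⟨1, 0, zero_mem _, 0, zero_mem _, by simp⟩
    · exact ⟨0, 1, one_mem_LL g, 0, zero_mem _, by simp⟩
    · exact ⟨0, 0, zero_mem _, 1, one_mem_LL g, by simp⟩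
  | succ j ih =>
    have hLle : LL g * LL g ^ (j + 1) ≤ S := by
      show Submodule.span k (Set.range g) * _ ≤ S
      rw [← H.hL, Submodule.mul_le]
      intro m hm n hn
      have hm' : Submodule.span k {h0, h1, h2} ≤ S.comap (LinearMap.mulRight k n) := by
        rw [Submodule.span_le]
        rintro x (rfl | rfl | rfl)
        · obtain ⟨γ, α, hα, β, hβ, rfl⟩ := ih hn
          refine ⟨γ, x * α, ?_, x * β, ?_, ?_⟩
          · rw [pow_succ']; exact Submodule.mul_mem_mul H.mem0 hα
          · rw [pow_succ']; exact Submodule.mul_mem_mul H.mem0 hβ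
          · simp only [LinearMap.mulRight_apply, smul_eq_C_mul]; ring
        · exact ⟨0, n, hn, 0, zero_mem _, by simp⟩
        · exact ⟨0, 0, zero_mem _, n, hn, by simp⟩
      exact hm' hm
    rw [pow_succ']
    exact hLle


lemma decomp0 (H : PData d g h0 h1 h2 c p1 p2 e δ) (hq0 : eval q h0 ≠ 0) (hq1 : eval q h1 = 0) (hq2 : eval q h2 = 0)
    (j : ℕ) {f : MvPolynomial (Fin 2) k} (hf : f ∈ LL g ^ (j + 1)) (hfq : eval q f = 0) :
    ∃ α ∈ LL g ^ j, ∃ β ∈ LL g ^ j, f = h1 * α + h2 * β := by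
  obtain ⟨γ, α, hα, β, hβ, rfl⟩ := H.decomp j hf
  refine ⟨α, hα, β, hβ, ?_⟩
  simp only [smul_eq_C_mul, map_add, map_mul, eval_C, map_pow, hq1, hq2, zero_mul, add_zero] at hfq
  have : γ = 0 := by
    rcases mul_eq_zero.mp hfq with h | h
    · exact h
    · exact absurd h (pow_ne_zero _ hq0)
  rw [this, zero_smul, zero_add]

lemma const_of_zero {f : MvPolynomial (Fin 2) k} (hf : f ∈ LL g ^ 0) : ∃ γ : k, f = C γ := by
  rw [pow_zero] at hf
  obtain ⟨γ, rfl⟩ := Submodule.mem_one.mp hf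
  exact ⟨γ, rfl⟩

lemma relprime (H : PData d g h0 h1 h2 c p1 p2 e δ) (hq0 : eval q h0 ≠ 0) (hq1 : eval q h1 = 0) (hq2 : eval q h2 = 0)
    (j : ℕ) {s : MvPolynomial (Fin 2) k} (hs : s ∈ LL g ^ j) (hsq : eval q s ≠ 0) :
    IsRelPrime c s := by
  cases j with
  | zero =>
    obtain ⟨γ, rfl⟩ := const_of_zero hs
    rw [eval_C] at hsq
    intro π _ hπ
    exact isUnit_of_dvd_unit hπ ((isUnit_iff_ne_zero.mpr hsq).map C)
  | succ j =>
    obtain ⟨γ, α, hα, β, hβ, rfl⟩ := H.decomp j hs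
    have hγ : γ ≠ 0 := by
      rintro rfl
      simp [hq1, hq2] at hsq
    intro π hπc hπs
    have hπ1 : π ∣ h1 := H.hh1 ▸ hπc.mul_right _
    have hπ2 : π ∣ h2 := H.hh2 ▸ hπc.mul_right _
    rw [add_assoc] at hπs
    have h3 := (dvd_add_left (dvd_add (hπ1.mul_right α) (hπ2.mul_right β))).mp hπs
    have h4 : π ∣ h0 ^ (j + 1) := by
      have h5 := h3.mul_left (C γ⁻¹)
      rwa [smul_eq_C_mul, ← mul_assoc, ← C_mul, inv_mul_cancel₀ hγ, C_1, one_mul] at h5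
    exact (H.hch.pow_right (n := j + 1)) hπc h4

lemma dvd_of_eval (H : PData d g h0 h1 h2 c p1 p2 e δ) (hq0 : eval q h0 ≠ 0) (hq1 : eval q h1 = 0) (hq2 : eval q h2 = 0)
    (j : ℕ) {f : MvPolynomial (Fin 2) k} (hf : f ∈ LL g ^ j) (hfq : eval q f = 0) :
    c ∣ f := by
  cases j with
  | zero =>
    obtain ⟨γ, rfl⟩ := const_of_zero hf
    rw [eval_C] at hfq
    rw [hfq, C_0]; exact dvd_zero _
  | succ j =>
    obtain ⟨α, hα, β, hβ, rfl⟩ := H.decomp0 hq0 hq1 hq2 j hf hfq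
    have hπ1 : c ∣ h1 := H.hh1 ▸ dvd_mul_right _ _
    have hπ2 : c ∣ h2 := H.hh2 ▸ dvd_mul_right _ _
    exact dvd_add (hπ1.mul_right α) (hπ2.mul_right β)

/-- `h₀` as element of the cone ring -/
lemma mem_cone0 (H : PData d g h0 h1 h2 c p1 p2 e δ) : h0 ∈ coneRing g := Algebra.span_le_adjoin k _ H.mem0

variable {a : Fin 3 → k}

lemma mem_iff (H : PData d g h0 h1 h2 c p1 p2 e δ) (hq0 : eval q h0 ≠ 0) (hq1 : eval q h1 = 0) (hq2 : eval q h2 = 0)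
    (hP1 : ∀ x ∈ pointIdeal g a, eval q (x : MvPolynomial (Fin 2) k) = 0)
    (hP2 : ∀ x α β : coneRing g, (x : MvPolynomial (Fin 2) k) = h1 * α + h2 * β → x ∈ pointIdeal g a)
    (x : FractionRing (coneRing g)) :
    x ∈ curveLocalRing g a ↔ ∃ j f s, RepO g q x j f s := by
  constructor
  · intro hx
    induction hx using Subring.closure_induction with
    | mem x hx =>
      obtain ⟨f, s, n, hf, hs, hsp, hsx⟩ := hx
      have hs0 : (s : MvPolynomial (Fin 2) k) ≠ 0 := by
        intro h
        have : s = 0 := Subtype.ext h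
        exact hsp (this ▸ zero_mem _)
      obtain ⟨j, rfl, hsj⟩ := adjoin_homog H.hd H.hg s.2 hs hs0
      have hfj : (f : MvPolynomial (Fin 2) k) ∈ LL g ^ j := by
        by_cases hf0 : (f : MvPolynomial (Fin 2) k) = 0
        · rw [hf0]; exact zero_mem _
        · obtain ⟨i, hi, hfi⟩ := adjoin_homog H.hd H.hg f.2 hf hf0
          rwa [← Nat.eq_of_mul_eq_mul_left H.hd hi] at hfi
      refine ⟨j, f, s, hfj, hsj, ?_, hsx⟩
      intro hsq
      apply hsp
      cases j with
      | zero =>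
        obtain ⟨γ, hγ⟩ := const_of_zero hsj
        rw [hγ, eval_C] at hsq
        rw [hsq, C_0] at hγ
        exact absurd hγ hs0
      | succ j =>
        obtain ⟨α, hα, β, hβ, h⟩ := H.decomp0 hq0 hq1 hq2 j hsj hsq
        exact hP2 s ⟨α, pow_le_adjoin g j hα⟩ ⟨β, pow_le_adjoin g j hβ⟩ h
    | zero => exact ⟨_, _, _, by simpa using RepO.const (g := g) (q := q) (0 : k)⟩
    | one => exact ⟨_, _, _, by simpa using RepO.const (g := g) (q := q) (1 : k)⟩
    | add x y _ _ hx hy =>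
      obtain ⟨_, _, _, hx⟩ := hx
      obtain ⟨_, _, _, hy⟩ := hy
      exact ⟨_, _, _, hx.add hy⟩
    | neg x _ hx =>
      obtain ⟨_, _, _, hx⟩ := hx
      exact ⟨_, _, _, hx.neg⟩
    | mul x y _ _ hx hy =>
      obtain ⟨_, _, _, hx⟩ := hx
      obtain ⟨_, _, _, hy⟩ := hy
      exact ⟨_, _, _, hx.mul hy⟩
  · rintro ⟨j, f, s, hf, hs, hsq, hx⟩
    exact Subring.subset_closure ⟨f, s, d * j, pow_homog H.L_le j hf, pow_homog H.L_le j hs,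
      fun h => hsq (hP1 s h), hx⟩

lemma isUnit_iff (H : PData d g h0 h1 h2 c p1 p2 e δ) (hq0 : eval q h0 ≠ 0) (hq1 : eval q h1 = 0) (hq2 : eval q h2 = 0)
    (hP1 : ∀ x ∈ pointIdeal g a, eval q (x : MvPolynomial (Fin 2) k) = 0)
    (hP2 : ∀ x α β : coneRing g, (x : MvPolynomial (Fin 2) k) = h1 * α + h2 * β → x ∈ pointIdeal g a)
    (x : curveLocalRing g a) {j f s} (hx : RepO g q x.1 j f s) :
    IsUnit x ↔ eval q (f : MvPolynomial (Fin 2) k) ≠ 0 := by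
  constructor
  · intro hu hf
    obtain ⟨y, hy⟩ := hu.exists_right_inv
    obtain ⟨i, f', s', hy'⟩ := (H.mem_iff hq0 hq1 hq2 hP1 hP2 y.1).mp y.2
    have h1 := (hx.mul hy').2.2.2
    have h2 : (x.1 * y.1 : FractionRing (coneRing g)) = 1 := congrArg Subtype.val hy
    rw [h2, mul_one] at h1
    have h3 := IsFractionRing.injective (coneRing g) (FractionRing (coneRing g)) h1
    have h4 := (hx.mul hy').2.2.1
    rw [h3] at h4
    apply h4
    simp [hf]
  · intro hf
    have hi := hx.inv hf
    refine IsUnit.of_mul_eq_one ⟨x.1⁻¹, (H.mem_iff hq0 hq1 hq2 hP1 hP2 _).mpr ⟨_, _, _, hi⟩⟩ ?_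
    apply Subtype.ext
    show x.1 * x.1⁻¹ = 1
    refine mul_inv_cancel₀ ?_
    intro h0
    have := hx.2.2.2
    rw [h0, mul_zero] at this
    have hf0 : f ≠ 0 := by rintro rfl; exact hf (by simp)
    exact RepO.mapne hf0 this.symm

lemma isLocal (H : PData d g h0 h1 h2 c p1 p2 e δ) (hq0 : eval q h0 ≠ 0) (hq1 : eval q h1 = 0) (hq2 : eval q h2 = 0)
    (hP1 : ∀ x ∈ pointIdeal g a, eval q (x : MvPolynomial (Fin 2) k) = 0)
    (hP2 : ∀ x α β : coneRing g, (x : MvPolynomial (Fin 2) k) = h1 * α + h2 * β → x ∈ pointIdeal g a)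
    : IsLocalRing (curveLocalRing g a) := by
  refine IsLocalRing.of_nonunits_add ?_
  intro x y hx hy
  obtain ⟨i, f, s, hx'⟩ := (H.mem_iff hq0 hq1 hq2 hP1 hP2 x.1).mp x.2
  obtain ⟨j, f', s', hy'⟩ := (H.mem_iff hq0 hq1 hq2 hP1 hP2 y.1).mp y.2
  rw [mem_nonunits_iff, H.isUnit_iff hq0 hq1 hq2 hP1 hP2 x hx', not_not] at hx
  rw [mem_nonunits_iff, H.isUnit_iff hq0 hq1 hq2 hP1 hP2 y hy', not_not] at hy
  rw [mem_nonunits_iff, H.isUnit_iff hq0 hq1 hq2 hP1 hP2 (x + y) (hx'.add hy'), not_not]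
  simp [hx, hy]

lemma nu_eq {O : Subring (FractionRing (coneRing g))} [IsLocalRing O] :
    nuIdeal O = IsLocalRing.maximalIdeal O := by
  refine le_antisymm ?_ ?_
  · exact Ideal.span_le.mpr fun x hx => hx
  · intro x hx
    exact Ideal.subset_span hx

lemma pow_max (H : PData d g h0 h1 h2 c p1 p2 e δ) (hq0 : eval q h0 ≠ 0) (hq1 : eval q h1 = 0) (hq2 : eval q h2 = 0)
    (hP1 : ∀ x ∈ pointIdeal g a, eval q (x : MvPolynomial (Fin 2) k) = 0)
    (hP2 : ∀ x α β : coneRing g, (x : MvPolynomial (Fin 2) k) = h1 * α + h2 * β → x ∈ pointIdeal g a)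
    [IsLocalRing (curveLocalRing g a)] (n : ℕ) (x : curveLocalRing g a)
    (hx : x ∈ IsLocalRing.maximalIdeal (curveLocalRing g a) ^ n) :
    ∃ j f s, RepO g q x.1 j f s ∧ c ^ n ∣ (f : MvPolynomial (Fin 2) k) := by
  induction n generalizing x with
  | zero =>
    obtain ⟨i, f, s, hx'⟩ := (H.mem_iff hq0 hq1 hq2 hP1 hP2 x.1).mp x.2
    exact ⟨i, f, s, hx', by simp⟩
  | succ n ih =>
    rw [pow_succ] at hx
    induction hx using Submodule.mul_induction_on' with
    | mem_mul_mem x hx y hy =>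
      obtain ⟨i, f, s, hx', hxc⟩ := ih x hx
      obtain ⟨j, f', s', hy'⟩ := (H.mem_iff hq0 hq1 hq2 hP1 hP2 y.1).mp y.2
      refine ⟨_, _, _, hx'.mul hy', ?_⟩
      rw [IsLocalRing.mem_maximalIdeal, mem_nonunits_iff,
        H.isUnit_iff hq0 hq1 hq2 hP1 hP2 y hy', not_not] at hy
      rw [pow_succ]
      exact mul_dvd_mul hxc (H.dvd_of_eval hq0 hq1 hq2 j hy'.1 hy)
    | add x _ y _ hx hy =>
      obtain ⟨i, f, s, hx', hxc⟩ := hx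
      obtain ⟨j, f', s', hy', hyc⟩ := hy
      exact ⟨_, _, _, hx'.add hy', dvd_add (hxc.mul_right _) (hyc.mul_left _)⟩

end PData

end ConcreteRing

section ConcreteMult

variable {k : Type*} [Field k] {d : ℕ} {g : Fin 3 → MvPolynomial (Fin 2) k}
    {h0 h1 h2 c p1 p2 : MvPolynomial (Fin 2) k} {e δ : ℕ} {q : Fin 2 → k}

theorem mult_concrete (H : PData d g h0 h1 h2 c p1 p2 e δ)
    (hbir : ∀ v ∈ Algebra.adjoin k {f : MvPolynomial (Fin 2) k | f.IsHomogeneous d},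
      ∃ x ∈ Algebra.adjoin k (Set.range g), ∃ y ∈ Algebra.adjoin k (Set.range g),
        y ≠ 0 ∧ y * v = x)
    (hq0 : eval q h0 ≠ 0) (hq1 : eval q h1 = 0) (hq2 : eval q h2 = 0) {a : Fin 3 → k}
    (hP1 : ∀ x ∈ pointIdeal g a, eval q (x : MvPolynomial (Fin 2) k) = 0)
    (hP2 : ∀ x α β : coneRing g, (x : MvPolynomial (Fin 2) k) = h1 * α + h2 * β →
      x ∈ pointIdeal g a) :
    IsHSMultOfDimOne (curveLocalRing g a) (nuIdeal (curveLocalRing g a)) e := by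
  have hmem := H.mem_iff hq0 hq1 hq2 hP1 hP2
  haveI hloc : IsLocalRing (curveLocalRing g a) := H.isLocal hq0 hq1 hq2 hP1 hP2
  letI : Algebra k (curveLocalRing g a) := RingHom.toAlgebra
    ((algebraMap k (FractionRing (coneRing g))).codRestrict (curveLocalRing g a)
      (fun α => (hmem _).mpr ⟨_, _, _, RepO.const α⟩))
  have hsm : ∀ (α : k) (x : curveLocalRing g a),
      (α • x).1 = algebraMap k (FractionRing (coneRing g)) α * x.1 := fun α x => rfl
  have ham : ∀ (α : k), (algebraMap k (curveLocalRing g a) α).1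
      = algebraMap k (FractionRing (coneRing g)) α := fun α => rfl
  have hinj := IsFractionRing.injective (coneRing g) (FractionRing (coneRing g))
  obtain ⟨ι, hι⟩ : ∃ ι : coneRing g →+* FractionRing (coneRing g),
    ι = algebraMap (coneRing g) (FractionRing (coneRing g)) := ⟨_, rfl⟩
  let z : coneRing g := ⟨h0, H.mem_cone0⟩
  have hz0 : z ≠ 0 := fun h => H.h00 (congrArg Subtype.val h)
  have hιz : ∀ N, ι z ^ N ≠ 0 := fun N => pow_ne_zero _ (hι ▸ RepO.mapne hz0)
  have hzN : ∀ N, (((z ^ N : coneRing g)) : MvPolynomial (Fin 2) k) ∈ LL g ^ N := fun N =>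
    Submodule.pow_mem_pow _ H.mem0 N
  have hLc : ∀ {N f}, f ∈ LL g ^ N → f ∈ coneRing g := fun {N f} hf => pow_le_adjoin g N hf
  have hrep : ∀ N f (hf : f ∈ LL g ^ N), RepO g q (ι ⟨f, hLc hf⟩ / ι z ^ N) N ⟨f, hLc hf⟩ (z ^ N) := by
    intro N f hf
    refine ⟨hf, hzN N, ?_, ?_⟩
    · have : ((z ^ N : coneRing g) : MvPolynomial (Fin 2) k) = h0 ^ N := rfl
      rw [this, map_pow]; exact pow_ne_zero _ hq0
    · rw [← hι, map_pow]; exact mul_div_cancel₀ _ (hιz N)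
  have hTex : ∀ N, ∃ T : MvPolynomial (Fin 2) k →ₗ[k] curveLocalRing g a,
      ∀ f (hf : f ∈ LL g ^ N), (T f).1 = ι ⟨f, hLc hf⟩ / ι z ^ N := by
    intro N
    let T0 : ↥(LL g ^ N) →ₗ[k] curveLocalRing g a :=
      { toFun := fun f => ⟨ι ⟨f.1, hLc f.2⟩ / ι z ^ N, (hmem _).mpr ⟨_, _, _, hrep N f.1 f.2⟩⟩
        map_add' := by
          intro x y
          apply Subtype.ext
          show ι _ / _ = ι _ / _ + ι _ / _
          rw [← add_div, ← map_add]; rfl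
        map_smul' := by
          intro α x
          apply Subtype.ext
          rw [hsm]
          show ι _ / _ = _ * (ι _ / _)
          rw [← mul_div_assoc]
          congr 1
          have : algebraMap k (FractionRing (coneRing g)) α = ι (algebraMap k (coneRing g) α) := by
            rw [hι]; rfl
          rw [RingHom.id_apply, this, ← map_mul]
          congr 1
          apply Subtype.ext
          show α • x.1 = algebraMap k _ α * x.1
          rw [Algebra.smul_def] }
    obtain ⟨T, hT⟩ := LinearMap.exists_extend T0
    refine ⟨T, fun f hf => ?_⟩
    have : T f = T0 ⟨f, hf⟩ := by rw [← hT]; rfl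
    rw [this]; rfl
  choose T hT using hTex
  have hm1 : ∀ {f}, f ∈ LL g → f ∈ LL g ^ 1 := fun {f} hf => by rwa [pow_one]
  have hrepT : ∀ N f (hf : f ∈ LL g ^ N), RepO g q (T N f).1 N ⟨f, hLc hf⟩ (z ^ N) := by
    intro N f hf
    rw [hT N f hf]; exact hrep N f hf
  have hmax : ∀ f ∈ LL g, eval q f = 0 → T 1 f ∈ IsLocalRing.maximalIdeal (curveLocalRing g a) := by
    intro f hf hfq
    rw [IsLocalRing.mem_maximalIdeal, mem_nonunits_iff,
      H.isUnit_iff hq0 hq1 hq2 hP1 hP2 _ (hrepT 1 f (hm1 hf)), not_not]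
    exact hfq
  rw [PData.nu_eq]
  refine mult_abstract H hbir T ?_ ?_ ?_ (hmax _ H.mem1 hq1) (hmax _ H.mem2 hq2) ?_ ?_
  · apply Subtype.ext
    rw [hT 0 1 (one_mem_LL g), pow_zero, div_one]
    exact map_one ι
  · apply Subtype.ext
    rw [hT 1 h0 (hm1 H.mem0), pow_one]
    exact div_self (by simpa using hιz 1)
  · intro N M f f' hf hf'
    have hff : f * f' ∈ LL g ^ (N + M) := by rw [pow_add]; exact Submodule.mul_mem_mul hf hf'
    apply Subtype.ext
    show (T (N + M) (f * f')).1 = (T N f).1 * (T M f').1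
    rw [hT _ _ hff, hT _ _ hf, hT _ _ hf', div_mul_div_comm, ← pow_add, ← map_mul]
    rfl
  · intro x
    obtain ⟨j, f, s, hf, hs, hsq, hx⟩ := (hmem _).mp x.2
    set γ : k := eval q (f : MvPolynomial (Fin 2) k) / eval q (s : MvPolynomial (Fin 2) k) with hγ
    have hlin : (h0 * ((f : MvPolynomial (Fin 2) k) - γ • (s : MvPolynomial (Fin 2) k))) ∈ LL g ^ (j + 1) := by
      rw [pow_succ']
      exact Submodule.mul_mem_mul H.mem0 (sub_mem hf (Submodule.smul_mem _ _ hs))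
    have hev : eval q (h0 * ((f : MvPolynomial (Fin 2) k) - γ • (s : MvPolynomial (Fin 2) k))) = 0 := by
      rw [map_mul, map_sub, smul_eval, hγ, div_mul_cancel₀ _ hsq, sub_self, mul_zero]
    obtain ⟨α, hα, β, hβ, hab⟩ := H.decomp0 hq0 hq1 hq2 j hlin hev
    have hs0 : s ≠ 0 := by rintro rfl; exact hsq (by simp)
    have hιs : ι s ≠ 0 := hι ▸ RepO.mapne hs0
    have hfrac : ∀ θ (hθ : θ ∈ LL g ^ j), ι ⟨θ, hLc hθ⟩ / ι s ∈ curveLocalRing g a := by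
      intro θ hθ
      refine (hmem _).mpr ⟨j, ⟨θ, hLc hθ⟩, s, hθ, hs, hsq, ?_⟩
      rw [← hι]; exact mul_div_cancel₀ _ hιs
    refine ⟨γ, ⟨_, hfrac α hα⟩, ⟨_, hfrac β hβ⟩, ?_⟩
    apply Subtype.ext
    show x.1 = (algebraMap k (curveLocalRing g a) γ).1 + (T 1 h1).1 * _ + (T 1 h2).1 * _
    rw [ham, hT _ _ (hm1 H.mem1), hT _ _ (hm1 H.mem2)]
    have hk : algebraMap k (FractionRing (coneRing g)) γ = ι (algebraMap k (coneRing g) γ) := by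
      rw [hι]; rfl
    have hιz1 : ι z ≠ 0 := by simpa using hιz 1
    have hx' : x.1 = ι f / ι s := by
      rw [eq_div_iff hιs, mul_comm, hι]; exact hx
    have habι : z * (f - algebraMap k (coneRing g) γ * s) =
        ⟨h1, hLc (hm1 H.mem1)⟩ * ⟨α, hLc hα⟩ + ⟨h2, hLc (hm1 H.mem2)⟩ * ⟨β, hLc hβ⟩ := by
      apply Subtype.ext
      show h0 * ((f : MvPolynomial (Fin 2) k) - algebraMap k _ γ * (s : MvPolynomial (Fin 2) k)) = h1 * α + h2 * β
      rw [← hab, Algebra.smul_def]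
    have habι' := congrArg ι habι
    simp only [map_mul, map_add, map_sub] at habι'
    rw [hk, hx', pow_one]
    field_simp
    linear_combination habι'
  · intro N n f hf hfn
    obtain ⟨j, f', s', hr, hdiv⟩ := H.pow_max hq0 hq1 hq2 hP1 hP2 n _ hfn
    have hrel := (H.relprime hq0 hq1 hq2 j hr.2.1 hr.2.2.1).pow_left (m := n)
    have e1 := hr.2.2.2
    rw [hT N f hf, ← hι] at e1
    have e2 : ι s' * ι ⟨f, hLc hf⟩ = ι f' * ι z ^ N := by
      have := hιz N
      field_simp at e1
      rw [e1, mul_comm]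
    rw [← map_pow, ← map_mul, ← map_mul, hι] at e2
    have e3 := congrArg Subtype.val (hinj e2)
    change (s' : MvPolynomial (Fin 2) k) * f = (f' : MvPolynomial (Fin 2) k) * h0 ^ N at e3
    have e4 : c ^ n ∣ (s' : MvPolynomial (Fin 2) k) * f := by rw [e3]; exact hdiv.mul_right _
    exact hrel.dvd_of_dvd_mul_left e4

end ConcreteMult

section HilbertBurch

variable {k : Type*} [Field k]

lemma gcd_of_height {R : Type*} [CommRing R] [IsDomain R] [IsNoetherianRing R] {g : Fin 3 → R}
    (hht : idealHeight (Ideal.span (Set.range g)) = 2) (π : R) (hπ : ∀ i, π ∣ g i) :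
    IsUnit π := by
  by_contra hu
  have hne : Ideal.span {π} ≠ ⊤ := by
    rwa [Ne, Ideal.span_singleton_eq_top]
  obtain ⟨P, hP⟩ := Ideal.nonempty_minimalPrimes hne
  have hPp : P.IsPrime := hP.1.1
  have h1 : P.height ≤ 1 := Ideal.height_le_one_of_isPrincipal_of_mem_minimalPrimes _ P hP
  have h2 : idealHeight (Ideal.span (Set.range g)) ≤ Order.height (⟨P, hPp⟩ : PrimeSpectrum R) := by
    refine iInf₂_le _ ?_
    rw [Ideal.span_le]
    rintro _ ⟨i, rfl⟩
    have : π ∈ P := hP.1.2 (Ideal.mem_span_singleton_self π)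
    exact P.mem_of_dvd (hπ i) this
  rw [hht, ← PrimeSpectrum.height_eq_orderHeight] at h2
  have h3 : (2 : ℕ∞) ≤ 1 := h2.trans h1
  exact absurd h3 (by decide)

lemma dvd_of_forall_dvd_mul {R : Type*} [CommRing R] [IsDomain R] [UniqueFactorizationMonoid R]
    {g : Fin 3 → R} (hgcd : ∀ π, (∀ i, π ∣ g i) → IsUnit π) {π r : R}
    (h : ∀ i, π ∣ g i * r) : π ∣ r := by
  by_cases hr : r = 0
  · rw [hr]; exact dvd_zero _
  obtain ⟨r', π', w, hrel, rfl, rfl⟩ := UniqueFactorizationMonoid.exists_reduced_factors r hr π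
  have hw : w ≠ 0 := by rintro rfl; simp at hr
  have hu : IsUnit π' := by
    refine hgcd _ fun i => ?_
    have h1 : w * π' ∣ w * (g i * r') := by
      have := h i
      rwa [show g i * (w * r') = w * (g i * r') by ring] at this
    exact hrel.symm.dvd_of_dvd_mul_right ((mul_dvd_mul_iff_left hw).mp h1)
  exact mul_dvd_mul_left w (hu.dvd)

lemma homog_le_of_dvd {p f : MvPolynomial (Fin 2) k} {m n : ℕ} (hp : p.IsHomogeneous m)
    (hf : f.IsHomogeneous n) (hf0 : f ≠ 0) (h : p ∣ f) : m ≤ n := by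
  obtain ⟨r, rfl⟩ := h
  obtain ⟨i, j, hij, hi, hj⟩ := homog_factor hf hf0
  have : m = i := hp.inj_right hi (left_ne_zero_of_mul hf0)
  omega

/-- generalized row of `φ` -/
noncomputable def rowOf (φ : Matrix (Fin 3) (Fin 2) (MvPolynomial (Fin 2) k)) (a : Fin 3 → k)
    (j : Fin 2) : MvPolynomial (Fin 2) k :=
  C (a 0) * φ 0 j + C (a 1) * φ 1 j + C (a 2) * φ 2 j

/-- the maximal minors -/
noncomputable def minorOf {R : Type*} [CommRing R] (φ : Matrix (Fin 3) (Fin 2) R) (i j : Fin 3) : R :=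
  φ i 0 * φ j 1 - φ j 0 * φ i 1

lemma hilbert_burch {d d₁ d₂ : ℕ}
    {g : Fin 3 → MvPolynomial (Fin 2) k} (hg : ∀ i, (g i).IsHomogeneous d)
    (hg0 : ∀ i, g i ≠ 0)
    (hgcd : ∀ π, (∀ i, π ∣ g i) → IsUnit π)
    {φ : Matrix (Fin 3) (Fin 2) (MvPolynomial (Fin 2) k)}
    (hinj : Function.Injective φ.mulVecLin)
    (hz : ∀ j, g 0 * φ 0 j + g 1 * φ 1 j + g 2 * φ 2 j = 0)
    (hcol1 : ∀ i, (φ i 0).IsHomogeneous d₁) (hcol2 : ∀ i, (φ i 1).IsHomogeneous d₂)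
    (hsum : d₁ + d₂ = d) :
    ∃ l : k, l ≠ 0 ∧ minorOf φ 1 2 = C l * g 0 ∧ minorOf φ 2 0 = C l * g 1 ∧
      minorOf φ 0 1 = C l * g 2 := by
  have z0 := hz 0
  have z1 := hz 1
  have hd0 : ∀ j, g 0 ∣ g j * minorOf φ 1 2 := by
    intro j
    fin_cases j
    · exact dvd_mul_right _ _
    · refine ⟨minorOf φ 2 0, ?_⟩
      simp only [minorOf]
      simp
      linear_combination (φ 2 1) * z0 - φ 2 0 * z1
    · refine ⟨minorOf φ 0 1, ?_⟩
      simp only [minorOf]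
      simp
      linear_combination (-φ 1 1) * z0 + φ 1 0 * z1
  obtain ⟨l, hl⟩ := dvd_of_forall_dvd_mul hgcd hd0
  have e1 : minorOf φ 2 0 = l * g 1 := by
    apply mul_left_cancel₀ (hg0 0)
    rw [show g 0 * (l * g 1) = g 1 * (g 0 * l) by ring, ← hl]
    simp only [minorOf]
    linear_combination (-φ 2 1) * z0 + φ 2 0 * z1
  have e2 : minorOf φ 0 1 = l * g 2 := by
    apply mul_left_cancel₀ (hg0 0)
    rw [show g 0 * (l * g 2) = g 2 * (g 0 * l) by ring, ← hl]
    simp only [minorOf]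
    linear_combination (φ 1 1) * z0 - φ 1 0 * z1
  have hl0 : l ≠ 0 := by
    rintro rfl
    simp only [zero_mul, mul_zero] at hl e1 e2
    have key : ∀ i j, φ j 0 * φ i 1 - φ j 1 * φ i 0 = 0 := by
      simp only [minorOf] at hl e1 e2
      intro i j
      fin_cases i <;> fin_cases j <;> simp
      · ring
      · linear_combination -e2
      · linear_combination e1
      · linear_combination e2
      · ring
      · linear_combination -hl
      · linear_combination -e1
      · linear_combination hl
      · ring
    have hall : ∀ i, φ i 0 = 0 := by
      intro i
      have : φ.mulVecLin ![φ i 1, - φ i 0] = φ.mulVecLin 0 := by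
        rw [map_zero]
        funext j
        simp [Matrix.mulVec, dotProduct, Fin.sum_univ_two]
        linear_combination key i j
      have := congrFun (hinj this) 1
      simpa using this
    have : φ.mulVecLin ![1, 0] = φ.mulVecLin 0 := by
      rw [map_zero]
      funext j
      simp [Matrix.mulVec, dotProduct, Fin.sum_univ_two, hall]
    have := congrFun (hinj this) 0
    simp at this
  have hhom : (g 0 * l).IsHomogeneous d := by
    rw [← hl, ← hsum]
    exact ((hcol1 1).mul (hcol2 2)).sub ((hcol1 2).mul (hcol2 1))
  obtain ⟨i, j, hij, hi, hj⟩ := homog_factor hhom (mul_ne_zero (hg0 0) hl0)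
  have : d = i := (hg 0).inj_right hi (hg0 0)
  have hj0 : j = 0 := by omega
  subst hj0
  have hlC : l = C (coeff 0 l) := by
    rw [← totalDegree_eq_zero_iff_eq_C]
    exact hj.totalDegree hl0
  refine ⟨coeff 0 l, ?_, ?_, ?_, ?_⟩
  · intro h
    rw [h, C_0] at hlC
    exact hl0 hlC
  · rw [← hlC, hl, mul_comm]
  · rw [← hlC, e1]
  · rw [← hlC, e2]

lemma dvd_row_iff {g : Fin 3 → MvPolynomial (Fin 2) k}
    (hgcd : ∀ π, (∀ i, π ∣ g i) → IsUnit π)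
    {φ : Matrix (Fin 3) (Fin 2) (MvPolynomial (Fin 2) k)}
    (hz : ∀ j, g 0 * φ 0 j + g 1 * φ 1 j + g 2 * φ 2 j = 0)
    {l : k} (hl : l ≠ 0) (e0 : minorOf φ 1 2 = C l * g 0) (e1 : minorOf φ 2 0 = C l * g 1)
    (e2 : minorOf φ 0 1 = C l * g 2) (a : Fin 3 → k) (π : MvPolynomial (Fin 2) k) :
    (∀ i j, π ∣ C (a i) * g j - C (a j) * g i) ↔ ∀ j, π ∣ rowOf φ a j := by
  have hu : ∀ x, π ∣ C l * x → π ∣ x := by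
    intro x hx
    have := hx.mul_left (C l⁻¹)
    rwa [← mul_assoc, ← C_mul, inv_mul_cancel₀ hl, C_1, one_mul] at this
  constructor
  · intro h j
    apply dvd_of_forall_dvd_mul hgcd
    intro i
    have : g i * rowOf φ a j = φ 0 j * (C (a 0) * g i - C (a i) * g 0)
      + φ 1 j * (C (a 1) * g i - C (a i) * g 1) + φ 2 j * (C (a 2) * g i - C (a i) * g 2) := by
      simp only [rowOf]
      linear_combination (C (a i)) * hz j
    rw [this]
    exact dvd_add (dvd_add ((h _ _).mul_left _) ((h _ _).mul_left _)) ((h _ _).mul_left _)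
  · intro h
    have hr : ∀ x y, π ∣ x * rowOf φ a 0 + y * rowOf φ a 1 := fun x y =>
      dvd_add ((h 0).mul_left _) ((h 1).mul_left _)
    have h01 : π ∣ C (a 0) * g 1 - C (a 1) * g 0 := by
      apply hu
      convert hr (-φ 2 1) (φ 2 0) using 1
      simp only [rowOf, minorOf] at *
      linear_combination (-C (a 0)) * e1 + C (a 1) * e0
    have h02 : π ∣ C (a 0) * g 2 - C (a 2) * g 0 := by
      apply hu
      convert hr (φ 1 1) (-φ 1 0) using 1
      simp only [rowOf, minorOf] at *
      linear_combination (-C (a 0)) * e2 + C (a 2) * e0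
    have h12 : π ∣ C (a 1) * g 2 - C (a 2) * g 1 := by
      apply hu
      convert hr (-φ 0 1) (φ 0 0) using 1
      simp only [rowOf, minorOf] at *
      linear_combination (-C (a 1)) * e2 + C (a 2) * e1
    intro i j
    fin_cases i <;> fin_cases j <;> simp
    · exact h01
    · exact h02
    · rw [← dvd_neg, neg_sub]; exact h01
    · exact h12
    · rw [← dvd_neg, neg_sub]; exact h02
    · rw [← dvd_neg, neg_sub]; exact h12

end HilbertBurch

section PointMult

variable {k : Type*} [Field k]

lemma fin3_choice {a : Fin 3 → k} (ha : a ≠ 0) :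
    ∃ i0 i1 i2 : Fin 3, a i0 ≠ 0 ∧ i1 ≠ i0 ∧ i2 ≠ i0 ∧ ∀ i, i = i0 ∨ i = i1 ∨ i = i2 := by
  obtain ⟨i, hi⟩ := Function.ne_iff.mp ha
  have key : ∀ i : Fin 3, ∃ i1 i2 : Fin 3, i1 ≠ i ∧ i2 ≠ i ∧ ∀ j, j = i ∨ j = i1 ∨ j = i2 := by
    decide
  obtain ⟨i1, i2, h⟩ := key i
  exact ⟨i, i1, i2, hi, h⟩

theorem point_mult {d : ℕ} (hd : 0 < d)
    {g : Fin 3 → MvPolynomial (Fin 2) k} (hg : ∀ i, (g i).IsHomogeneous d)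
    (hmin : LinearIndependent k g)
    (hgcd : ∀ π, (∀ i, π ∣ g i) → IsUnit π)
    (hbir : ∀ v ∈ Algebra.adjoin k {f : MvPolynomial (Fin 2) k | f.IsHomogeneous d},
      ∃ x ∈ Algebra.adjoin k (Set.range g), ∃ y ∈ Algebra.adjoin k (Set.range g),
        y ≠ 0 ∧ y * v = x)
    {a : Fin 3 → k} (ha : a ≠ 0) (haC : onCurve g a) :
    ∃ (c : MvPolynomial (Fin 2) k) (e : ℕ), c ≠ 0 ∧ c.IsHomogeneous e ∧
      (∀ π, π ∣ c ↔ ∀ i j, π ∣ C (a i) * g j - C (a j) * g i) ∧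
      IsHSMultOfDimOne (curveLocalRing g a) (nuIdeal (curveLocalRing g a)) e ∧
      VV k (d + d) ≤ LL g * VV k d := by
  obtain ⟨q, hq, t, ht, hat⟩ := haC
  obtain ⟨i0, i1, i2, ha0, hi1, hi2, hcov⟩ := fin3_choice ha
  have hne : ∀ i, i ≠ i0 → ∀ s : k, g i - C s * g i0 ≠ 0 := by
    intro i hi s h
    have := Fintype.linearIndependent_iff.mp hmin (Pi.single i 1 - Pi.single i0 s) (by
      simp only [Pi.sub_apply, sub_smul, Finset.sum_sub_distrib, Pi.single_apply, ite_smul,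
        zero_smul, Finset.sum_ite_eq', Finset.mem_univ, if_true, one_smul]
      rw [smul_eq_C_mul]; exact h) i
    simp [hi] at this
  have hgne : ∀ i, g i ≠ 0 := fun i => hmin.ne_zero i
  -- `hh i = g i - (a i / a i0) g i0`
  let hh : Fin 3 → MvPolynomial (Fin 2) k := fun i => g i - C (a i / a i0) * g i0
  have hhh : ∀ i, (hh i).IsHomogeneous d := by
    intro i
    have := (isHomogeneous_C (Fin 2) (a i / a i0)).mul (hg i0)
    rw [zero_add] at this
    exact (hg i).sub this
  have hh0 : hh i0 = 0 := by simp [hh, div_self ha0]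
  have hdiff : ∀ i j, C (a i) * g j - C (a j) * g i = C (a i) * hh j - C (a j) * hh i := by
    intro i j
    have : C (a i) * C (a j / a i0) = (C (a j) * C (a i / a i0) : MvPolynomial (Fin 2) k) := by
      rw [← C_mul, ← C_mul]; congr 1; ring
    simp only [hh]
    linear_combination g i0 * this
  have hhi : ∀ i, C (a i0) * hh i = C (a i0) * g i - C (a i) * g i0 := by
    intro i
    have : C (a i0) * C (a i / a i0) = (C (a i) : MvPolynomial (Fin 2) k) := by
      rw [← C_mul]; congr 1; field_simp
    simp only [hh]
    linear_combination (-g i0) * this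
  have hCinv : ∀ x : MvPolynomial (Fin 2) k, x = C (a i0)⁻¹ * (C (a i0) * x) := by
    intro x; rw [← mul_assoc, ← C_mul, inv_mul_cancel₀ ha0, C_1, one_mul]
  obtain ⟨p1, p2, c, hp, hc1, hc2⟩ :=
    UniqueFactorizationMonoid.exists_reduced_factors (hh i1) (hne i1 hi1 _) (hh i2)
  have h1ne : c * p1 ≠ 0 := hc1 ▸ hne i1 hi1 _
  have h2ne : c * p2 ≠ 0 := hc2 ▸ hne i2 hi2 _
  obtain ⟨e, δ, hed, hce, hp1⟩ := homog_factor (hc1 ▸ hhh i1) h1ne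
  obtain ⟨e', δ', hed', hce', hp2⟩ := homog_factor (hc2 ▸ hhh i2) h2ne
  have hc0 := left_ne_zero_of_mul h1ne
  have hee : e = e' := hce.inj_right hce' hc0
  obtain rfl : δ = δ' := by omega
  have hcall : ∀ i, c ∣ hh i := by
    intro i
    rcases hcov i with rfl | rfl | rfl
    · rw [hh0]; exact dvd_zero _
    · exact ⟨_, hc1.symm⟩
    · exact ⟨_, hc2.symm⟩
  have hch : IsRelPrime c (g i0) := by
    intro π hπc hπ0
    refine hgcd π fun i => ?_
    have h1 : π ∣ hh i := hπc.trans (hcall i)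
    have h2 := dvd_add h1 (hπ0.mul_left (C (a i / a i0)))
    simpa [hh] using h2
  have hL : Submodule.span k {g i0, hh i1, hh i2} = Submodule.span k (Set.range g) := by
    apply le_antisymm
    · have hm : ∀ i, hh i ∈ Submodule.span k (Set.range g) := by
        intro i
        refine sub_mem (Submodule.subset_span ⟨i, rfl⟩) ?_
        rw [← smul_eq_C_mul]
        exact Submodule.smul_mem _ _ (Submodule.subset_span ⟨i0, rfl⟩)
      rw [Submodule.span_le]
      rintro x (rfl | rfl | rfl)
      · exact Submodule.subset_span ⟨i0, rfl⟩
      · exact hm _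
      · exact hm _
    · rw [Submodule.span_le]
      rintro _ ⟨i, rfl⟩
      have hm : hh i ∈ Submodule.span k {g i0, hh i1, hh i2} := by
        rcases hcov i with rfl | rfl | rfl
        · rw [hh0]; exact zero_mem _
        · exact Submodule.subset_span (by simp)
        · exact Submodule.subset_span (by simp)
      have : g i = hh i + (a i / a i0) • g i0 := by simp [hh, smul_eq_C_mul]
      rw [this]
      exact add_mem hm (Submodule.smul_mem _ _ (Submodule.subset_span (by simp)))
  have H : PData d g (g i0) (hh i1) (hh i2) c p1 p2 e δ :=
    { hd := hd, hg := hg, hL := hL, h00 := hgne i0, hc0 := hc0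
      hp10 := right_ne_zero_of_mul h1ne, hp20 := right_ne_zero_of_mul h2ne
      hh1 := hc1.symm, hh2 := hc2.symm, hc := hce, hp1 := hp1, hp2 := hp2, hed := hed
      hp := hp, hch := hch }
  have hq0 : eval q (g i0) ≠ 0 := by
    intro h
    apply ha0
    rw [hat, h, mul_zero]
  have hqi : ∀ i, eval q (hh i) = 0 := by
    intro i
    simp only [hh, map_sub, map_mul, eval_C, hat]
    field_simp
    ring
  refine ⟨c, e, hc0, hce, ?_, mult_concrete H hbir hq0 (hqi _) (hqi _) ?_ ?_,
    H.Lstep le_rfl⟩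
  · intro π
    constructor
    · intro h i j
      rw [hdiff]
      exact dvd_sub ((h.trans (hcall j)).mul_left _) ((h.trans (hcall i)).mul_left _)
    · intro h
      have hπ : ∀ i, π ∣ hh i := by
        intro i
        rw [hCinv (hh i), hhi]
        exact (h _ _).mul_left _
      have hπ1 := hπ i1
      have hπ2 := hπ i2
      rw [← hc1] at hπ1
      rw [← hc2] at hπ2
      obtain ⟨c', π', w, hrel, rfl, rfl⟩ := UniqueFactorizationMonoid.exists_reduced_factors c hc0 π
      have hw : w ≠ 0 := left_ne_zero_of_mul hc0
      rw [mul_assoc, mul_dvd_mul_iff_left hw] at hπ1 hπ2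
      have hu := hp (hrel.symm.dvd_of_dvd_mul_left hπ1) (hrel.symm.dvd_of_dvd_mul_left hπ2)
      exact mul_dvd_mul_left w hu.dvd
  · intro x hx
    let ev : coneRing g →+* k := (eval q).comp (coneRing g).val.toRingHom
    have : pointIdeal g a ≤ RingHom.ker ev := by
      refine Ideal.span_le.mpr ?_
      rintro _ ⟨i, j, rfl⟩
      show eval q (a i • g j - a j • g i) = 0
      rw [map_sub, smul_eval, smul_eval, hat, hat]; ring
    exact this hx
  · intro x α β hx
    have hm : ∀ i, ∃ y ∈ pointIdeal g a, (y : MvPolynomial (Fin 2) k) = hh i := by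
      intro i
      have h1 : a i0 • coneGen g i - a i • coneGen g i0 ∈ pointIdeal g a :=
        Ideal.subset_span ⟨i0, i, rfl⟩
      refine ⟨algebraMap k (coneRing g) (a i0)⁻¹ * (a i0 • coneGen g i - a i • coneGen g i0),
        Ideal.mul_mem_left _ _ h1, ?_⟩
      rw [hCinv (hh i), hhi]
      show C (a i0)⁻¹ * (a i0 • g i - a i • g i0) = _
      rw [smul_eq_C_mul, smul_eq_C_mul]
    obtain ⟨y1, hy1, e1⟩ := hm i1
    obtain ⟨y2, hy2, e2⟩ := hm i2
    have : x = y1 * α + y2 * β := by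
      apply Subtype.ext
      rw [hx, ← e1, ← e2]; rfl
    rw [this]
    exact add_mem (Ideal.mul_mem_right _ _ hy1) (Ideal.mul_mem_right _ _ hy2)

lemma mult_unique {R : Type*} [CommRing R] {J : Ideal R} {m n : ℕ}
    (hm : IsHSMultOfDimOne R J m) (hn : IsHSMultOfDimOne R J n) : m = n := by
  obtain ⟨l, h1, h2⟩ := hm
  obtain ⟨l', h1', h2'⟩ := hn
  have : l = l' := by
    funext i
    have := (h1 i).symm.trans (h1' i)
    exact_mod_cast this
  subst this
  exact_mod_cast tendsto_nhds_unique h2 h2'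

end PointMult

section FinalLemmas

variable {k : Type*} [Field k]

lemma eval_scale {f : MvPolynomial (Fin 2) k} {n : ℕ} (hf : f.IsHomogeneous n) (u : k)
    (v : Fin 2 → k) : eval (fun i => u * v i) f = u ^ n * eval v f := by
  rw [eval_eq, eval_eq, Finset.mul_sum]
  refine Finset.sum_congr rfl fun s hs => ?_
  have : s.degree = n := by
    have := hf (mem_support_iff.mp hs)
    rwa [Finsupp.degree_eq_weight_one]
  rw [← this, Finsupp.degree_apply]
  simp only [mul_pow, Finset.prod_mul_distrib, Finset.prod_pow_eq_pow_sum]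
  ring

lemma exists_root [IsAlgClosed k] {f : MvPolynomial (Fin 2) k} {n : ℕ} (hf : f.IsHomogeneous n)
    (hn : 0 < n) : ∃ q : Fin 2 → k, q ≠ 0 ∧ eval q f = 0 := by
  let P : Polynomial k := aeval ![Polynomial.X, 1] f
  have hP : ∀ t, P.eval t = eval ![t, 1] f := by
    intro t
    have : (Polynomial.aeval t).comp (aeval ![Polynomial.X, (1 : Polynomial k)])
        = (aeval ![t, 1] : MvPolynomial (Fin 2) k →ₐ[k] k) := by
      apply MvPolynomial.algHom_ext
      intro i
      fin_cases i <;> simp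
    have h2 := DFunLike.congr_fun this f
    simpa [P, Polynomial.coe_aeval_eq_eval, aeval_eq_eval] using h2
  let Q : Polynomial k := aeval ![1, Polynomial.X] f
  have hQ : ∀ t, Q.eval t = eval ![1, t] f := by
    intro t
    have : (Polynomial.aeval t).comp (aeval ![(1 : Polynomial k), Polynomial.X])
        = (aeval ![1, t] : MvPolynomial (Fin 2) k →ₐ[k] k) := by
      apply MvPolynomial.algHom_ext
      intro i
      fin_cases i <;> simp
    have h2 := DFunLike.congr_fun this f
    simpa [Q, Polynomial.coe_aeval_eq_eval, aeval_eq_eval] using h2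
  by_cases hdeg : P.degree = 0
  · obtain ⟨s, hPC⟩ : ∃ s, P = Polynomial.C s := ⟨_, Polynomial.eq_C_of_degree_eq_zero hdeg⟩
    have hQs : Q = Polynomial.C s * Polynomial.X ^ n := by
      apply Polynomial.eq_of_infinite_eval_eq
      refine Set.Infinite.mono ?_ ((Set.finite_singleton (0 : k)).infinite_compl)
      intro u hu
      have hu0 : u ≠ 0 := hu
      show Q.eval u = _
      rw [hQ]
      have h1 : (![1, u] : Fin 2 → k) = fun i => u * ![u⁻¹, 1] i := by
        funext i; fin_cases i <;> simp [hu0]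
      rw [h1, eval_scale hf, ← hP, hPC]
      rw [Polynomial.eval_C, Polynomial.eval_mul, Polynomial.eval_C, Polynomial.eval_pow,
        Polynomial.eval_X, mul_comm]
    refine ⟨![1, 0], fun h => by simpa using congrFun h 0, ?_⟩
    rw [← hQ, hQs]
    simp [hn.ne']
  · obtain ⟨t, ht⟩ := IsAlgClosed.exists_root P hdeg
    refine ⟨![t, 1], fun h => by simpa using congrFun h 1, ?_⟩
    rw [← hP]; exact ht

lemma rowOf_homog {φ : Matrix (Fin 3) (Fin 2) (MvPolynomial (Fin 2) k)} {j : Fin 2} {n : ℕ}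
    (h : ∀ i, (φ i j).IsHomogeneous n) (a : Fin 3 → k) : (rowOf φ a j).IsHomogeneous n := by
  have : ∀ i, (C (a i) * φ i j).IsHomogeneous n := by
    intro i
    have := (isHomogeneous_C (Fin 2) (a i)).mul (h i)
    rwa [zero_add] at this
  exact ((this 0).add (this 1)).add (this 2)

lemma exists_row_zero {φ : Matrix (Fin 3) (Fin 2) (MvPolynomial (Fin 2) k)}
    (h : ∀ i, (φ i 0).IsHomogeneous 1) : ∃ a : Fin 3 → k, a ≠ 0 ∧ rowOf φ a 0 = 0 := by
  let F : (Fin 3 → k) →ₗ[k] VV k 1 :=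
    { toFun := fun a => ⟨rowOf φ a 0, rowOf_homog h a⟩
      map_add' := by
        intro x y
        apply Subtype.ext
        simp [rowOf]; ring
      map_smul' := by
        intro x y
        apply Subtype.ext
        simp [rowOf, smul_eq_C_mul]; ring }
  have hfr : Module.finrank k (VV k 1) = 2 := finrank_VV 1
  haveI : Module.Finite k (VV k 1) := Module.finite_of_finrank_pos (by omega)
  have hker : LinearMap.ker F ≠ ⊥ := LinearMap.ker_ne_bot_of_finrank_lt (by rw [hfr]; simp)
  obtain ⟨a, haF, ha⟩ := Submodule.exists_mem_ne_zero_of_ne_bot hker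
  exact ⟨a, ha, congrArg Subtype.val haF⟩

lemma row_ne {g : Fin 3 → MvPolynomial (Fin 2) k} (hmin : LinearIndependent k g)
    {a : Fin 3 → k} (ha : a ≠ 0) : ¬ ∀ i j, C (a i) * g j - C (a j) * g i = 0 := by
  intro h
  obtain ⟨i0, i1, i2, ha0, hi1, -, -⟩ := fin3_choice ha
  have := Fintype.linearIndependent_iff.mp hmin (Pi.single i1 (a i0) - Pi.single i0 (a i1)) (by
      simp only [Pi.sub_apply, sub_smul, Finset.sum_sub_distrib, Pi.single_apply, ite_smul,
        zero_smul, Finset.sum_ite_eq', Finset.mem_univ, if_true]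
      rw [smul_eq_C_mul, smul_eq_C_mul]; exact h _ _) i1
  simp [hi1] at this
  exact ha0 this

lemma eval_ne_of_le {d : ℕ} {g : Fin 3 → MvPolynomial (Fin 2) k}
    (hV : VV k (d + d) ≤ LL g * VV k d) {q : Fin 2 → k} (hq : q ≠ 0) :
    ∃ i, eval q (g i) ≠ 0 := by
  by_contra! hcon
  apply hq
  have hz : LL g * VV k d ≤ LinearMap.ker (aeval q : MvPolynomial (Fin 2) k →ₐ[k] k).toLinearMap := by
    rw [Submodule.mul_le]
    intro m hm n _
    have hm' : LL g ≤ LinearMap.ker (aeval q : MvPolynomial (Fin 2) k →ₐ[k] k).toLinearMap := by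
      rw [Submodule.span_le]
      rintro _ ⟨i, rfl⟩
      simpa [aeval_eq_eval] using hcon i
    have h0 : aeval q m = 0 := hm' hm
    show aeval q (m * n) = 0
    rw [map_mul, h0, zero_mul]
  funext i
  have hx : (X i ^ (d + d) : MvPolynomial (Fin 2) k) ∈ VV k (d + d) := isHomogeneous_X_pow i _
  have h1 : aeval q (X i ^ (d + d) : MvPolynomial (Fin 2) k) = 0 := hz (hV hx)
  rw [map_pow, aeval_X] at h1
  exact eq_zero_of_pow_eq_zero h1

end FinalLemmas

/-- Adopt the data of a rational plane curve: `k` an algebraically closed field, `B = k[x,y]`,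
`g₁, g₂, g₃` forms of degree `d` generating a height-2 ideal minimally, with the morphism
`Ψ : ℙ¹ → C ⊆ ℙ²` birational (equivalently, `k[g₁,g₂,g₃]` and the Veronese `k[B_d]` have the
same quotient field), and `φ` a homogeneous Hilbert–Burch matrix with column degrees `d₁ ≤ d₂`
(`d₁ + d₂ = d`).  Then for every point `p` on `C` with multiplicity `m_p = e(O_{C,p})`:
(1) `m_p ≤ d₂`; (2) if `m_p < d₂` then `m_p ≤ d₁`; and (3) `C` has a singularity of
multiplicity `d − 1` (a point of multiplicity `d − 1`) if and only if `d₁ = 1`. -/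
theorem stmt11 {k : Type*} [Field k] [IsAlgClosed k] (d d₁ d₂ : ℕ) (hd : 0 < d)
    (g : Fin 3 → MvPolynomial (Fin 2) k) (hg : ∀ i, (g i).IsHomogeneous d)
    (hmin : LinearIndependent k g)
    (hht : idealHeight (Ideal.span (Set.range g)) = 2)
    (hbir : ∀ v ∈ Algebra.adjoin k {f : MvPolynomial (Fin 2) k | f.IsHomogeneous d},
      ∃ x ∈ Algebra.adjoin k (Set.range g), ∃ y ∈ Algebra.adjoin k (Set.range g),
        y ≠ 0 ∧ y * v = x)
    (φ : Matrix (Fin 3) (Fin 2) (MvPolynomial (Fin 2) k))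
    (hHBinj : Function.Injective φ.mulVecLin)
    (hHBexact : LinearMap.range φ.mulVecLin =
      LinearMap.ker (Matrix.mulVecLin (Matrix.of fun (_ : Fin 1) (i : Fin 3) => g i)))
    (hcol1 : ∀ i, (φ i 0).IsHomogeneous d₁) (hcol2 : ∀ i, (φ i 1).IsHomogeneous d₂)
    (h12 : d₁ ≤ d₂) (hsum : d₁ + d₂ = d)
    (a : Fin 3 → k) (ha : a ≠ 0) (haC : onCurve g a)
    (m : ℕ)
    (hm : IsHSMultOfDimOne (curveLocalRing g a) (nuIdeal (curveLocalRing g a)) m) :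
    m ≤ d₂ ∧ (m < d₂ → m ≤ d₁) ∧
      ((∃ a' : Fin 3 → k, a' ≠ 0 ∧ onCurve g a' ∧
          IsHSMultOfDimOne (curveLocalRing g a') (nuIdeal (curveLocalRing g a')) (d - 1)) ↔
        d₁ = 1) := by
  have hgcd := gcd_of_height hht
  have hg0 : ∀ i, g i ≠ 0 := fun i => hmin.ne_zero i
  have hz : ∀ j, g 0 * φ 0 j + g 1 * φ 1 j + g 2 * φ 2 j = 0 := by
    intro j
    have h1 : φ.mulVecLin (Pi.single j 1) ∈ LinearMap.range φ.mulVecLin := ⟨_, rfl⟩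
    rw [hHBexact, LinearMap.mem_ker] at h1
    have h2 := congrFun h1 0
    simpa [Matrix.mulVec, dotProduct, Fin.sum_univ_three] using h2
  obtain ⟨l, hl, e0, e1, e2⟩ := hilbert_burch hg hg0 hgcd hHBinj hz hcol1 hcol2 hsum
  have hrow := dvd_row_iff hgcd hz hl e0 e1 e2
  have hrne : ∀ a' : Fin 3 → k, a' ≠ 0 → rowOf φ a' 0 = 0 → rowOf φ a' 1 ≠ 0 := by
    intro a' ha' h0 h1
    refine row_ne hmin ha' fun i j => ?_
    rw [← zero_dvd_iff]
    refine (hrow a' 0).mpr (fun j => ?_) i j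
    fin_cases j
    · simp [h0]
    · simp [h1]
  have hmain : ∀ a' : Fin 3 → k, a' ≠ 0 → onCurve g a' → ∃ e,
      IsHSMultOfDimOne (curveLocalRing g a') (nuIdeal (curveLocalRing g a')) e ∧
      ((rowOf φ a' 0 ≠ 0 ∧ e ≤ d₁) ∨ (rowOf φ a' 0 = 0 ∧ e = d₂)) := by
    intro a' ha' hC
    obtain ⟨c, e, hc0, hce, hdvd, hmul, -⟩ := point_mult hd hg hmin hgcd hbir ha' hC
    refine ⟨e, hmul, ?_⟩
    have hcr : ∀ j, c ∣ rowOf φ a' j := (hrow a' c).mp ((hdvd c).mp dvd_rfl)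
    by_cases h0 : rowOf φ a' 0 = 0
    · right
      refine ⟨h0, le_antisymm ?_ ?_⟩
      · exact homog_le_of_dvd hce (rowOf_homog hcol2 a') (hrne a' ha' h0) (hcr 1)
      · refine homog_le_of_dvd (rowOf_homog hcol2 a') hce hc0 ?_
        rw [hdvd, hrow]
        intro j
        fin_cases j
        · simp [h0]
        · simp
    · left
      exact ⟨h0, homog_le_of_dvd hce (rowOf_homog hcol1 a') h0 (hcr 0)⟩
  have hd1 : 0 < d₁ := by
    rcases Nat.eq_zero_or_pos d₁ with h | h
    · exfalso
      subst h
      have hC : ∀ i, φ i 0 = C (coeff 0 (φ i 0)) := by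
        intro i
        by_cases hi : φ i 0 = 0
        · simp [hi]
        · rw [← totalDegree_eq_zero_iff_eq_C]
          exact (hcol1 i).totalDegree hi
      have hs := Fintype.linearIndependent_iff.mp hmin (fun i => coeff 0 (φ i 0)) (by
        rw [Fin.sum_univ_three]
        simp only [smul_eq_C_mul, ← hC]
        linear_combination hz 0)
      have hall : ∀ i, φ i 0 = 0 := by
        intro i; rw [hC i, hs i, C_0]
      have : φ.mulVecLin ![1, 0] = φ.mulVecLin 0 := by
        rw [map_zero]
        funext j
        simp [Matrix.mulVec, dotProduct, Fin.sum_univ_two, hall]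
      have := congrFun (hHBinj this) 0
      simp at this
    · exact h
  obtain ⟨e, he, hcase⟩ := hmain a ha haC
  have hme := mult_unique hm he
  subst hme
  refine ⟨?_, ?_, ?_, ?_⟩
  · rcases hcase with h | h <;> omega
  · intro hlt
    rcases hcase with h | h <;> omega
  · rintro ⟨a', ha', hC', hm'⟩
    obtain ⟨e', he', hcase'⟩ := hmain a' ha' hC'
    have := mult_unique hm' he'
    rcases hcase' with h | h <;> omega
  · intro h1
    subst h1
    obtain ⟨a', ha', hr0⟩ := exists_row_zero hcol1
    obtain ⟨q, hq, hr1⟩ := exists_root (rowOf_homog hcol2 a') (by omega : 0 < d₂)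
    obtain ⟨-, -, -, -, -, -, hV⟩ := point_mult hd hg hmin hgcd hbir ha haC
    obtain ⟨j, hj⟩ := eval_ne_of_le hV hq
    have r0 := congrArg (eval q) hr0
    have f0 := congrArg (eval q) e0
    have f1 := congrArg (eval q) e1
    have f2 := congrArg (eval q) e2
    simp only [rowOf, minorOf, map_add, map_sub, map_mul, eval_C, map_zero] at r0 hr1 f0 f1 f2
    have k01 : a' 0 * eval q (g 1) = a' 1 * eval q (g 0) := by
      apply mul_left_cancel₀ hl
      linear_combination (-a' 0) * f1 + a' 1 * f0 - eval q (φ 2 1) * r0 + eval q (φ 2 0) * hr1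
    have k02 : a' 0 * eval q (g 2) = a' 2 * eval q (g 0) := by
      apply mul_left_cancel₀ hl
      linear_combination (-a' 0) * f2 + a' 2 * f0 + eval q (φ 1 1) * r0 - eval q (φ 1 0) * hr1
    have k12 : a' 1 * eval q (g 2) = a' 2 * eval q (g 1) := by
      apply mul_left_cancel₀ hl
      linear_combination (-a' 1) * f2 + a' 2 * f1 - eval q (φ 0 1) * r0 + eval q (φ 0 0) * hr1
    have hk : ∀ i i', a' i * eval q (g i') = a' i' * eval q (g i) := by
      intro i i'
      fin_cases i <;> fin_cases i' <;> first | rfl | assumption | (symm; assumption)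
    have hai : ∀ i, a' i = a' j / eval q (g j) * eval q (g i) := by
      intro i
      field_simp
      exact hk i j
    have hC' : onCurve g a' := by
      refine ⟨q, hq, a' j / eval q (g j), ?_, hai⟩
      intro h
      apply ha'
      funext i
      rw [hai i, h, zero_mul]; rfl
    obtain ⟨e', he', hcase'⟩ := hmain a' ha' hC'
    refine ⟨a', ha', hC', ?_⟩
    have : d - 1 = e' := by
      rcases hcase' with h | h
      · exact absurd hr0 h.1
      · omega
    rw [this]
    exact he'
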